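/- arXiv:2009.10957 — 2 statements merged into one kernel-verified Lean document; each statement's English description precedes it below -/
import Mathlib

section
/- Let N ≥ 2, s ∈ (0,1), and μ ≥ μ_0. For every ξ ∈ C²_c(ℝ^N) there exists a constant c_0 = c_0(s,μ,ξ) > 0 such that for all x ∈ ℝ^N∖{0} the principal value limit defining (−Δ)^s_{Γ_μ} ξ(x) exists and |(−Δ)^s_{Γ_μ} ξ(x)| ≤ c_0 min{ Λ_μ(x), |x|^{−N−2s} }. -/
open MeasureTheory Filter Set Topology Metric

noncomputable section

/-- Euclidean space `ℝ^N`. -/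
abbrev EN (N : ℕ) := EuclideanSpace ℝ (Fin N)

/-- The normalizing constant `C_{N,s}` of the fractional Laplacian. -/
def CNs (N : ℕ) (s : ℝ) : ℝ :=
  2 ^ (2*s) * Real.pi ^ (-(N:ℝ)/2) * s * Real.Gamma ((N + 2*s)/2) / Real.Gamma (1 - s)

/-- The optimal fractional Hardy constant `μ₀`. -/
def mu0 (N : ℕ) (s : ℝ) : ℝ :=
  -(2 ^ (2*s) * Real.Gamma ((N + 2*s)/4) ^ 2 / Real.Gamma ((N - 2*s)/4) ^ 2)

/-- The function `τ ↦ c_s(τ)`. -/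
def csFun (N : ℕ) (s τ : ℝ) : ℝ :=
  2 ^ (2*s) * Real.Gamma ((N + τ)/2) * Real.Gamma ((2*s - τ)/2) /
    (Real.Gamma (-τ/2) * Real.Gamma ((N - 2*s + τ)/2))

/-- `u` has fractional Laplacian `(-Δ)^s u (x) = L` at `x`, as a principal value. -/
def HasFracLap (N : ℕ) (s : ℝ) (u : EN N → ℝ) (x : EN N) (L : ℝ) : Prop :=
  Tendsto (fun ε : ℝ =>
      CNs N s * ∫ z in {z : EN N | ε ≤ dist x z}, (u x - u z) / dist x z ^ ((N:ℝ) + 2*s))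
    (𝓝[>] 0) (𝓝 L)

/-- `v` has weighted fractional Laplacian `(-Δ)^s_{Γ_μ} v (x) = L` at `x`, where the weight
is `Γ_μ(z) = ‖z‖ ^ τp` with `τp = τ₊(s,μ)`. -/
def HasWFracLap (N : ℕ) (s τp : ℝ) (v : EN N → ℝ) (x : EN N) (L : ℝ) : Prop :=
  Tendsto (fun ε : ℝ =>
      CNs N s * ∫ z in {z : EN N | ε ≤ dist x z},
        (v x - v z) * ‖z‖ ^ τp / dist x z ^ ((N:ℝ) + 2*s))
    (𝓝[>] 0) (𝓝 L)

/-- Membership in `L¹(ℝ^N, dx/(1+|x|^{N+2s}))`. -/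
def MemL1w (N : ℕ) (s : ℝ) (u : EN N → ℝ) : Prop :=
  Integrable (fun x : EN N => u x / (1 + ‖x‖ ^ ((N:ℝ) + 2*s)))

/-- Membership in `L^∞_loc(ℝ^N \ {0})`. -/
def LocBddAway (N : ℕ) (u : EN N → ℝ) : Prop :=
  ∀ K : Set (EN N), IsCompact K → (0:EN N) ∉ K → ∃ C : ℝ, ∀ x ∈ K, |u x| ≤ C

/-- Local `θ`-Hölder continuity on compact subsets of `S`, i.e. `C^θ_loc(S)`. -/
def HolderLocOn (N : ℕ) (θ : ℝ) (f : EN N → ℝ) (S : Set (EN N)) : Prop :=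
  ∀ K ⊆ S, IsCompact K → ∃ C : ℝ, ∀ x ∈ K, ∀ y ∈ K, |f x - f y| ≤ C * dist x y ^ θ

/-- Membership in `L^∞_loc(S)`. -/
def LinfLocOn (N : ℕ) (f : EN N → ℝ) (S : Set (EN N)) : Prop :=
  AEMeasurable f ∧ ∀ K ⊆ S, IsCompact K → ∃ C : ℝ, ∀ x ∈ K, |f x| ≤ C

/-- A bounded `C²` domain: open, connected and bounded, whose boundary is the regular zero
level set of a `C²` defining function. -/
structure IsBoundedC2Domain (N : ℕ) (Ω : Set (EN N)) : Prop where
  isOpen : IsOpen Ω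
  isConnected : IsConnected Ω
  isBounded : Bornology.IsBounded Ω
  c2Boundary : ∃ φ : EN N → ℝ, ContDiff ℝ 2 φ ∧ Ω = {x | φ x < 0} ∧
    ∀ x ∈ frontier Ω, fderiv ℝ φ x ≠ 0

/-- A bounded domain: open, connected and bounded. -/
def IsBoundedDomain (N : ℕ) (Ω : Set (EN N)) : Prop :=
  IsOpen Ω ∧ IsConnected Ω ∧ Bornology.IsBounded Ω

/-- The first standard coordinate vector `e₁ ∈ ℝ^N`. -/
def e1 (N : ℕ) : EN N :=
  (EuclideanSpace.equiv (Fin N) ℝ).symm (fun i => if (i:ℕ) = 0 then 1 else 0)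

/-- The surface measure `ω_{N-1}` of the unit sphere in `ℝ^N`. -/
def omegaN (N : ℕ) : ℝ := N * (volume (ball (0 : EN N) 1)).toReal

/-- The normalization constant `c_{s,0}`. -/
def cs0 (N : ℕ) (s : ℝ) : ℝ :=
  CNs N s * omegaN N * ∫ t in Ioo (0:ℝ) 1, ∫ z in ball (0:EN N) t,
    (‖z‖ ^ (2*s - N) - 1) / ‖e1 N - z‖ ^ ((N:ℝ) + 2*s)

/-- The fundamental solution `Φ_μ`, expressed via the exponent `τ = τ₋(s,μ)`:
`Φ_μ(x) = |x|^τ` for `μ ≠ μ₀` and `Φ_{μ₀}(x) = -|x|^τ ln |x|`. -/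
def Phi (N : ℕ) (s μ τ : ℝ) (x : EN N) : ℝ :=
  if μ = mu0 N s then -(‖x‖ ^ τ * Real.log ‖x‖) else ‖x‖ ^ τ

/-- The integrand appearing in the definition of `c_{s,μ}`. -/
def cIntegrand (N : ℕ) (s μ τm τp : ℝ) (z : EN N) : ℝ :=
  if μ = mu0 N s then ‖z‖ ^ ((2*s - N)/2) * (-Real.log ‖z‖) / ‖e1 N - z‖ ^ ((N:ℝ) + 2*s)
  else (‖z‖ ^ τm - ‖z‖ ^ τp) / ‖e1 N - z‖ ^ ((N:ℝ) + 2*s)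

/-- The normalization constant `c_{s,μ}`. -/
def csmu (N : ℕ) (s μ τm τp : ℝ) : ℝ :=
  CNs N s * omegaN N * ∫ t in Ioo (0:ℝ) 1, ∫ z in ball (0:EN N) t, cIntegrand N s μ τm τp z

/-- The weight `Λ_μ`, expressed via `τp = τ₊(s,μ)`. -/
def Lam (N : ℕ) (s τp : ℝ) (x : EN N) : ℝ :=
  if 2*s - 1 < τp then 1
  else if τp < 2*s - 1 then ‖x‖ ^ (1 - 2*s + τp)
  else 1 + max (-Real.log ‖x‖) 0

/-- The quadratic form `E^s(u,v)`. -/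
def Es (N : ℕ) (s : ℝ) (u v : EN N → ℝ) : ℝ :=
  (CNs N s / 2) *
    ∫ p : EN N × EN N, (u p.1 - u p.2) * (v p.1 - v p.2) / dist p.1 p.2 ^ ((N:ℝ) + 2*s)

/-- The quadratic form `E^s_μ(u,v)`. -/
def Esmu (N : ℕ) (s μ : ℝ) (u v : EN N → ℝ) : ℝ :=
  Es N s u v + μ * ∫ x : EN N, u x * v x / ‖x‖ ^ (2*s)

/-- `E^s_{A,B}(u,u) < ∞`. -/
def FiniteEnergyOn (N : ℕ) (s : ℝ) (u : EN N → ℝ) (A B : Set (EN N)) : Prop :=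
  IntegrableOn (fun p : EN N × EN N => (u p.1 - u p.2)^2 / dist p.1 p.2 ^ ((N:ℝ) + 2*s)) (A ×ˢ B)

/-- Membership in `H^s(ℝ^N)`: locally `L²` with finite Gagliardo seminorm. -/
def MemHs (N : ℕ) (s : ℝ) (u : EN N → ℝ) : Prop :=
  (∀ K : Set (EN N), IsCompact K → IntegrableOn (fun x => (u x)^2) K) ∧
  FiniteEnergyOn N s u univ univ

/-- Membership in `H^s_0(Ω)`. -/
def MemHs0 (N : ℕ) (s : ℝ) (Ω : Set (EN N)) (u : EN N → ℝ) : Prop :=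
  MemHs N s u ∧ ∀ᵐ x : EN N, x ∉ Ω → u x = 0

/-- Membership in `W^s(Ω)`. -/
def MemWs (N : ℕ) (s : ℝ) (Ω : Set (EN N)) (u : EN N → ℝ) : Prop :=
  MemL1w N s u ∧ IntegrableOn (fun x => (u x)^2) Ω ∧
  ∃ Ω' : Set (EN N), IsOpen Ω' ∧ IsConnected Ω' ∧ closure Ω ⊆ Ω' ∧ FiniteEnergyOn N s u Ω Ω'

/-- Membership in `W^s_*(Ω)`. -/
def MemWsStar (N : ℕ) (s : ℝ) (Ω : Set (EN N)) (u : EN N → ℝ) : Prop :=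
  MemL1w N s u ∧ ∀ ε : ℝ, 0 < ε → MemWs N s (Ω \ closedBall 0 ε) u

/-- The distributional identity `L^s_μ u = f` in `Ω \ {0}`, tested against `C^∞_c(Ω\{0})`. -/
def DistrEq (N : ℕ) (s μ : ℝ) (Ω : Set (EN N)) (f u : EN N → ℝ) : Prop :=
  ∀ φ : EN N → ℝ, ContDiff ℝ (⊤ : ℕ∞) φ → HasCompactSupport φ → tsupport φ ⊆ Ω \ {0} →
    ∀ g : EN N → ℝ, (∀ x, HasFracLap N s φ x (g x)) →
      (∫ x, u x * g x) + μ * ∫ x, u x * φ x / ‖x‖ ^ (2*s) = ∫ x in Ω, f x * φ x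

/-- A distributional solution of `L^s_μ u = f` in `Ω \ {0}` with `u = 0` in `ℝ^N \ Ω`. -/
def IsDistrSol (N : ℕ) (s μ : ℝ) (Ω : Set (EN N)) (f u : EN N → ℝ) : Prop :=
  LocBddAway N u ∧ MemL1w N s u ∧ (∀ x ∉ Ω, u x = 0) ∧ DistrEq N s μ Ω f u


lemma rad_fun_eq (N : ℕ) (hN : 1 ≤ N) (p : ℝ) (S : Set ℝ) :
    EqOn (fun t : ℝ => t ^ (N - 1) • S.indicator (fun t => t ^ p) t)
      (S.indicator (fun t : ℝ => t ^ (p + N - 1))) (Ioi 0) := by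
  intro t ht
  have ht : 0 < t := ht
  by_cases h : t ∈ S
  · simp only [indicator_of_mem h, smul_eq_mul]
    rw [← Real.rpow_natCast, ← Real.rpow_add ht]
    push_cast [Nat.cast_sub hN]
    ring_nf
  · simp [indicator_of_notMem h]

lemma radial_integrable (N : ℕ) (hN : 1 ≤ N) (p : ℝ) (S : Set ℝ) (hS : MeasurableSet S)
    (h : IntegrableOn (fun t : ℝ => t ^ (p + N - 1)) (S ∩ Ioi 0)) :
    IntegrableOn (fun z : EN N => ‖z‖ ^ p) {z | ‖z‖ ∈ S} := by
  have hS' : MeasurableSet {z : EN N | ‖z‖ ∈ S} := measurable_norm hS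
  have : Nonempty (Fin N) := ⟨⟨0, hN⟩⟩
  rw [← integrable_indicator_iff hS']
  have := (integrable_fun_norm_addHaar (volume : Measure (EN N))
    (f := S.indicator (fun t => t ^ p))).2 (by
      have hd : Module.finrank ℝ (EN N) = N := by simp
      rw [hd]
      rw [integrableOn_congr_fun (rad_fun_eq N hN p S) measurableSet_Ioi]
      rw [integrableOn_indicator_iff hS]
      exact h)
  refine this.congr (ae_of_all _ fun z => ?_)
  simp [indicator]

lemma radial_integral (N : ℕ) (hN : 1 ≤ N) (p : ℝ) (S : Set ℝ) (hS : MeasurableSet S) :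
    ∫ z in {z : EN N | ‖z‖ ∈ S}, ‖z‖ ^ p = omegaN N * ∫ t in S ∩ Ioi 0, t ^ (p + N - 1) := by
  have hS' : MeasurableSet {z : EN N | ‖z‖ ∈ S} := measurable_norm hS
  have : Nonempty (Fin N) := ⟨⟨0, hN⟩⟩
  rw [← integral_indicator hS']
  have := integral_fun_norm_addHaar (volume : Measure (EN N)) (S.indicator (fun t => t ^ p))
  have hd : Module.finrank ℝ (EN N) = N := by simp
  rw [hd, setIntegral_congr_fun measurableSet_Ioi (rad_fun_eq N hN p S),
    setIntegral_indicator hS, inter_comm] at this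
  simp only [nsmul_eq_mul, smul_eq_mul] at this
  rw [omegaN, mul_assoc, ← Measure.real, ← this]
  refine integral_congr_ae (ae_of_all _ fun z => ?_)
  simp [indicator]

lemma omegaN_nonneg (N : ℕ) : 0 ≤ omegaN N := by
  unfold omegaN; positivity

lemma rad1 (N : ℕ) (hN : 1 ≤ N) (p a : ℝ) (hp : 0 < p + N) (ha : 0 ≤ a) :
    IntegrableOn (fun z : EN N => ‖z‖ ^ p) {z | ‖z‖ ∈ Iio a} ∧
    ∫ z in {z : EN N | ‖z‖ ∈ Iio a}, ‖z‖ ^ p = omegaN N * (a ^ (p + N) / (p + N)) := by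
  have hset : Iio a ∩ Ioi (0:ℝ) = Ioo 0 a := by ext t; simp [and_comm]
  have hp' : -1 < p + N - 1 := by linarith
  constructor
  · apply radial_integrable N hN p _ measurableSet_Iio
    rw [hset]
    exact (intervalIntegral.intervalIntegrable_rpow' hp' (a := 0) (b := a)).1.mono_set
      Ioo_subset_Ioc_self
  · rw [radial_integral N hN p _ measurableSet_Iio, hset, ← integral_Ioc_eq_integral_Ioo,
      ← intervalIntegral.integral_of_le ha, integral_rpow (Or.inl hp')]
    rw [show p + N - 1 + 1 = p + N by ring, Real.zero_rpow hp.ne', sub_zero]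

lemma rad2 (N : ℕ) (hN : 1 ≤ N) (p a : ℝ) (hp : p + N < 0) (ha : 0 < a) :
    IntegrableOn (fun z : EN N => ‖z‖ ^ p) {z | ‖z‖ ∈ Ici a} ∧
    ∫ z in {z : EN N | ‖z‖ ∈ Ici a}, ‖z‖ ^ p = omegaN N * (a ^ (p + N) / (-(p + N))) := by
  have hset : Ici a ∩ Ioi (0:ℝ) = Ici a := by
    ext t; simp only [mem_inter_iff, mem_Ici, mem_Ioi, and_iff_left_iff_imp]; intro h; linarith
  have hp' : p + N - 1 < -1 := by linarith
  constructor
  · apply radial_integrable N hN p _ measurableSet_Ici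
    rw [hset, integrableOn_Ici_iff_integrableOn_Ioi]
    exact integrableOn_Ioi_rpow_of_lt hp' ha
  · rw [radial_integral N hN p _ measurableSet_Ici, hset, integral_Ici_eq_integral_Ioi,
      integral_Ioi_rpow_of_lt hp' ha]
    rw [show p + N - 1 + 1 = p + N by ring, neg_div, div_neg]

lemma rad3 (N : ℕ) (hN : 1 ≤ N) (p a b : ℝ) (ha : 0 < a) (hab : a ≤ b) :
    IntegrableOn (fun z : EN N => ‖z‖ ^ p) {z | ‖z‖ ∈ Ico a b} ∧
    ∫ z in {z : EN N | ‖z‖ ∈ Ico a b}, ‖z‖ ^ p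
      = omegaN N * ∫ t in a..b, t ^ (p + N - 1) := by
  have hset : Ico a b ∩ Ioi (0:ℝ) = Ico a b := by
    ext t; simp only [mem_inter_iff, mem_Ico, mem_Ioi, and_iff_left_iff_imp]; intro h; linarith
  have h0 : (0:ℝ) ∉ Set.uIcc a b := by
    rw [uIcc_of_le hab]; intro h; linarith [h.1]
  constructor
  · apply radial_integrable N hN p _ measurableSet_Ico
    rw [hset, integrableOn_Ico_iff_integrableOn_Ioo]
    exact (intervalIntegral.intervalIntegrable_rpow (Or.inr h0)).1.mono_set
      Ioo_subset_Ioc_self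
  · rw [radial_integral N hN p _ measurableSet_Ico, hset,
      intervalIntegral.integral_of_le hab, integral_Ico_eq_integral_Ioo,
      integral_Ioc_eq_integral_Ioo]

lemma pow_comp {a t : ℝ} (p : ℝ) (ha : 0 < a) (h1 : a / 2 ≤ t) (h2 : t ≤ 3 / 2 * a) :
    t ^ p ≤ ((1/2 : ℝ) ^ p + (3/2 : ℝ) ^ p) * a ^ p := by
  have ht : 0 < t := by linarith
  have e1 : (1/2 : ℝ) ^ p * a ^ p = (a/2) ^ p := by
    rw [← Real.mul_rpow (by norm_num) ha.le]; ring_nf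
  have e2 : (3/2 : ℝ) ^ p * a ^ p = (3/2*a) ^ p := by
    rw [← Real.mul_rpow (by norm_num) ha.le]
  rw [add_mul, e1, e2]
  have p1 : 0 ≤ (a/2) ^ p := by positivity
  have p2 : 0 ≤ (3/2*a) ^ p := by positivity
  rcases le_total 0 p with hp | hp
  · have := Real.rpow_le_rpow ht.le h2 hp
    linarith
  · have := Real.rpow_le_rpow_of_nonpos (by positivity) h1 hp
    linarith

lemma pow_diff {a b : ℝ} (p : ℝ) (ha : 0 < a) (h1 : a / 2 ≤ b) (h2 : b ≤ 3 / 2 * a) :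
    |b ^ p - a ^ p| ≤ |p| * ((1/2 : ℝ) ^ (p-1) + (3/2 : ℝ) ^ (p-1)) * a ^ (p-1) * |b - a| := by
  have := Convex.norm_image_sub_le_of_norm_hasDerivWithin_le (𝕜 := ℝ)
    (f := fun t : ℝ => t ^ p) (f' := fun t => p * t ^ (p-1)) (s := Icc (a/2) (3/2*a))
    (C := |p| * ((1/2 : ℝ) ^ (p-1) + (3/2 : ℝ) ^ (p-1)) * a ^ (p-1)) (x := a) (y := b)
    (fun t ht => (Real.hasDerivAt_rpow_const
      (Or.inl (by have := ht.1; intro h; linarith))).hasDerivWithinAt)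
    (fun t ht => by
      have h3 := pow_comp (p-1) ha ht.1 ht.2
      have : 0 ≤ t ^ (p-1) := Real.rpow_nonneg (by linarith [ht.1]) _
      rw [norm_mul, Real.norm_eq_abs, Real.norm_eq_abs, abs_of_nonneg this, mul_assoc]
      exact mul_le_mul_of_nonneg_left h3 (abs_nonneg _))
    (convex_Icc _ _) ⟨by linarith, by linarith⟩ ⟨h1, h2⟩
  simpa [Real.norm_eq_abs] using this

lemma wint_measurable (N : ℕ) (τ q : ℝ) (ξ : EN N → ℝ) (hξ : Continuous ξ) (x : EN N) :
    Measurable (fun z : EN N => (ξ x - ξ z) * ‖z‖ ^ τ / dist x z ^ q) := by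
  have := hξ.measurable
  have h1 : Measurable (fun z : EN N => ‖z‖ ^ τ) := measurable_norm.pow_const τ
  have h2 : Measurable (fun z : EN N => dist x z ^ q) :=
    (Continuous.dist continuous_const continuous_id).measurable.pow_const q
  exact ((measurable_const.sub this).mul h1).div h2

lemma far_bound (N : ℕ) (hN : 2 ≤ N) (s τ : ℝ) (hs0 : 0 < s)
    (hτ1 : 0 < τ + N) (hτ2 : τ < 2 * s) :
    ∃ A : ℝ, 0 ≤ A ∧ ∀ (x : EN N) (T M K : ℝ) (ξ : EN N → ℝ), x ≠ 0 → ‖x‖ ≤ T → 0 ≤ M → 0 ≤ K →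
      Continuous ξ → (∀ z, |ξ x - ξ z| ≤ M) → (∀ z, |ξ x - ξ z| ≤ K * dist x z) →
      IntegrableOn (fun z : EN N => (ξ x - ξ z) * ‖z‖ ^ τ / dist x z ^ ((N:ℝ) + 2*s))
        {z | ‖x‖ / 2 ≤ dist x z} ∧
      |∫ z in {z : EN N | ‖x‖ / 2 ≤ dist x z},
        (ξ x - ξ z) * ‖z‖ ^ τ / dist x z ^ ((N:ℝ) + 2*s)| ≤
        A * (K * ‖x‖ ^ (1 - 2*s + τ) + K * (∫ t in ‖x‖..T, t ^ (τ - 2*s)) + M * T ^ (τ - 2*s)) := by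
  have hN' : (2:ℝ) ≤ N := by exact_mod_cast hN
  set q : ℝ := (N:ℝ) + 2*s with hq
  have hω := omegaN_nonneg N
  set A1 : ℝ := (1/2:ℝ) ^ (1 - q) * (omegaN N / (τ + N)) with hA1
  set A2 : ℝ := (1/3:ℝ) ^ (1 - q) * omegaN N with hA2
  set A3 : ℝ := (1/3:ℝ) ^ (-q) * (omegaN N / (2*s - τ)) with hA3
  have hA1p : 0 ≤ A1 := by positivity
  have hA2p : 0 ≤ A2 := by positivity
  have h2sτ : 0 < 2*s - τ := by linarith
  have hA3p : 0 ≤ A3 := by positivity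
  refine ⟨A1 + A2 + A3, by positivity, ?_⟩
  intro x T M K ξ hx hxT hM hK hξ hbM hbK
  have hx0 : 0 < ‖x‖ := norm_pos_iff.2 hx
  have hT0 : 0 < T := by linarith
  obtain ⟨i1, e1⟩ := rad1 N (by omega) τ ‖x‖ hτ1 hx0.le
  obtain ⟨i2, e2⟩ := rad3 N (by omega) (τ + 1 - q) ‖x‖ T hx0 hxT
  obtain ⟨i3, e3⟩ := rad2 N (by omega) (τ - q) T (by rw [hq]; linarith) hT0
  have m1 : MeasurableSet {z : EN N | ‖z‖ ∈ Iio ‖x‖} := measurable_norm measurableSet_Iio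
  have m2 : MeasurableSet {z : EN N | ‖z‖ ∈ Ico ‖x‖ T} := measurable_norm measurableSet_Ico
  have m3 : MeasurableSet {z : EN N | ‖z‖ ∈ Ici T} := measurable_norm measurableSet_Ici
  set G1 : EN N → ℝ := fun z => K * (‖x‖/2) ^ (1-q) *
    {z : EN N | ‖z‖ ∈ Iio ‖x‖}.indicator (fun z => ‖z‖ ^ τ) z with hG1
  set G2 : EN N → ℝ := fun z => K * (1/3:ℝ) ^ (1-q) *
    {z : EN N | ‖z‖ ∈ Ico ‖x‖ T}.indicator (fun z => ‖z‖ ^ (τ + 1 - q)) z with hG2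
  set G3 : EN N → ℝ := fun z => M * (1/3:ℝ) ^ (-q) *
    {z : EN N | ‖z‖ ∈ Ici T}.indicator (fun z => ‖z‖ ^ (τ - q)) z with hG3
  have I1 : Integrable G1 := ((integrable_indicator_iff m1).2 i1).const_mul _
  have I2 : Integrable G2 := ((integrable_indicator_iff m2).2 i2).const_mul _
  have I3 : Integrable G3 := ((integrable_indicator_iff m3).2 i3).const_mul _
  have P1 : ∀ z, 0 ≤ G1 z := fun z => mul_nonneg (by positivity)
    (indicator_nonneg (fun z _ => by positivity) z)
  have P2 : ∀ z, 0 ≤ G2 z := fun z => mul_nonneg (by positivity)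
    (indicator_nonneg (fun z _ => by positivity) z)
  have P3 : ∀ z, 0 ≤ G3 z := fun z => mul_nonneg (by positivity)
    (indicator_nonneg (fun z _ => by positivity) z)
  have IG : Integrable (fun z => G1 z + G2 z + G3 z) := (I1.add I2).add I3
  have mS : MeasurableSet {z : EN N | ‖x‖ / 2 ≤ dist x z} :=
    (isClosed_le continuous_const (Continuous.dist continuous_const continuous_id)).measurableSet
  have hbound : ∀ z ∈ {z : EN N | ‖x‖ / 2 ≤ dist x z},
      ‖(ξ x - ξ z) * ‖z‖ ^ τ / dist x z ^ q‖ ≤ G1 z + G2 z + G3 z := by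
    intro z hz
    have hz : ‖x‖ / 2 ≤ dist x z := hz
    have hd : 0 < dist x z := by linarith
    have hz3 : ‖z‖ / 3 ≤ dist x z := by
      have : ‖z‖ ≤ ‖x‖ + dist x z := by
        rw [dist_eq_norm]
        calc ‖z‖ = ‖x - (x - z)‖ := by congr 1; abel
          _ ≤ _ := norm_sub_le _ _
      linarith
    have hτz : 0 ≤ ‖z‖ ^ τ := by positivity
    have hn : ‖(ξ x - ξ z) * ‖z‖ ^ τ / dist x z ^ q‖
        = |ξ x - ξ z| * dist x z ^ (-q) * ‖z‖ ^ τ := by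
      rw [norm_div, norm_mul, Real.norm_eq_abs, Real.norm_eq_abs, Real.norm_eq_abs,
        abs_of_nonneg hτz, abs_of_nonneg (by positivity : 0 ≤ dist x z ^ q), Real.rpow_neg hd.le]
      ring
    have hdK : |ξ x - ξ z| * dist x z ^ (-q) ≤ K * dist x z ^ (1 - q) := by
      have : dist x z ^ (1 - q) = dist x z * dist x z ^ (-q) := by
        rw [sub_eq_add_neg, Real.rpow_add hd, Real.rpow_one]
      rw [this, ← mul_assoc]
      exact mul_le_mul_of_nonneg_right (hbK z) (by positivity)
    have hdM : |ξ x - ξ z| * dist x z ^ (-q) ≤ M * dist x z ^ (-q) :=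
      mul_le_mul_of_nonneg_right (hbM z) (by positivity)
    rw [hn]
    rcases lt_or_ge ‖z‖ ‖x‖ with h | h
    · have : |ξ x - ξ z| * dist x z ^ (-q) * ‖z‖ ^ τ ≤ G1 z := by
        simp only [hG1]
        rw [indicator_of_mem (show z ∈ {z : EN N | ‖z‖ ∈ Iio ‖x‖} from h)]
        refine mul_le_mul_of_nonneg_right (hdK.trans ?_) hτz
        exact mul_le_mul_of_nonneg_left
          (Real.rpow_le_rpow_of_nonpos (by positivity) hz (by rw [hq]; linarith)) hK
      linarith [P2 z, P3 z]
    have hz0 : 0 < ‖z‖ := by linarith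
    rcases lt_or_ge ‖z‖ T with h' | h'
    · have : |ξ x - ξ z| * dist x z ^ (-q) * ‖z‖ ^ τ ≤ G2 z := by
        simp only [hG2]
        rw [indicator_of_mem (show z ∈ {z : EN N | ‖z‖ ∈ Ico ‖x‖ T} from ⟨h, h'⟩)]
        have e : K * (1/3:ℝ) ^ (1-q) * ‖z‖ ^ (τ + 1 - q) = K * (‖z‖/3) ^ (1-q) * ‖z‖ ^ τ := by
          rw [show ‖z‖/3 = 1/3 * ‖z‖ by ring, Real.mul_rpow (by norm_num) hz0.le,
            show τ + 1 - q = (1-q) + τ by ring, Real.rpow_add hz0]; ring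
        rw [e]
        refine mul_le_mul_of_nonneg_right (hdK.trans ?_) hτz
        exact mul_le_mul_of_nonneg_left
          (Real.rpow_le_rpow_of_nonpos (by positivity) hz3 (by rw [hq]; linarith)) hK
      linarith [P1 z, P3 z]
    · have : |ξ x - ξ z| * dist x z ^ (-q) * ‖z‖ ^ τ ≤ G3 z := by
        simp only [hG3]
        rw [indicator_of_mem (show z ∈ {z : EN N | ‖z‖ ∈ Ici T} from h')]
        have e : M * (1/3:ℝ) ^ (-q) * ‖z‖ ^ (τ - q) = M * (‖z‖/3) ^ (-q) * ‖z‖ ^ τ := by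
          rw [show ‖z‖/3 = 1/3 * ‖z‖ by ring, Real.mul_rpow (by norm_num) hz0.le,
            show τ - q = (-q) + τ by ring, Real.rpow_add hz0]; ring
        rw [e]
        refine mul_le_mul_of_nonneg_right (hdM.trans ?_) hτz
        exact mul_le_mul_of_nonneg_left
          (Real.rpow_le_rpow_of_nonpos (by positivity) hz3 (by rw [hq]; linarith)) hM
      linarith [P1 z, P2 z]
  have hae := (ae_restrict_iff' (μ := (volume : Measure (EN N))) mS).2 (ae_of_all _ hbound)
  constructor
  · exact Integrable.mono' IG.integrableOn
      (wint_measurable N τ q ξ hξ x).aestronglyMeasurable hae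
  · have h1 := norm_integral_le_of_norm_le IG.integrableOn hae
    have h2 : ∫ z in {z : EN N | ‖x‖ / 2 ≤ dist x z}, (G1 z + G2 z + G3 z)
        ≤ ∫ z, (G1 z + G2 z + G3 z) := setIntegral_le_integral IG
          (ae_of_all _ fun z => add_nonneg (add_nonneg (P1 z) (P2 z)) (P3 z))
    have h3 : ∫ z, (G1 z + G2 z + G3 z) = (∫ z, G1 z) + (∫ z, G2 z) + ∫ z, G3 z := by
      rw [integral_add (f := fun z => G1 z + G2 z) (I1.add I2) I3, integral_add I1 I2]
    have v1 : ∫ z, G1 z = A1 * (K * ‖x‖ ^ (1 - 2*s + τ)) := by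
      simp only [hG1]
      rw [integral_const_mul, integral_indicator m1, e1, hA1,
        show ‖x‖/2 = 1/2 * ‖x‖ by ring, Real.mul_rpow (by norm_num) hx0.le,
        show 1 - 2*s + τ = (1 - q) + (τ + N) by rw [hq]; ring, Real.rpow_add hx0 (1 - q) (τ + N)]
      ring
    have v2 : ∫ z, G2 z = A2 * (K * (∫ t in ‖x‖..T, t ^ (τ - 2*s))) := by
      simp only [hG2]
      rw [integral_const_mul, integral_indicator m2, e2, hA2,
        show τ + 1 - q + N - 1 = τ - 2*s by rw [hq]; ring]
      ring
    have v3 : ∫ z, G3 z = A3 * (M * T ^ (τ - 2*s)) := by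
      simp only [hG3]
      rw [integral_const_mul, integral_indicator m3, e3, hA3,
        show τ - q + N = τ - 2*s by rw [hq]; ring, show -(τ - 2*s) = 2*s - τ by ring]
      ring
    have n1 : 0 ≤ K * ‖x‖ ^ (1 - 2*s + τ) := by positivity
    have n2 : 0 ≤ K * (∫ t in ‖x‖..T, t ^ (τ - 2*s)) := mul_nonneg hK
      (intervalIntegral.integral_nonneg hxT fun t ht => Real.rpow_nonneg (by linarith [ht.1]) _)
    have n3 : 0 ≤ M * T ^ (τ - 2*s) := by positivity
    rw [Real.norm_eq_abs] at h1
    rw [h3, v1, v2, v3] at h2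
    have := h1.trans h2
    nlinarith [mul_nonneg hA1p n2, mul_nonneg hA1p n3, mul_nonneg hA2p n1, mul_nonneg hA2p n3,
      mul_nonneg hA3p n1, mul_nonneg hA3p n2]

lemma far_large (N : ℕ) (hN : 2 ≤ N) (s τ : ℝ) (hs0 : 0 < s) (hτ1 : 0 < τ + N)
    (x : EN N) (R M : ℝ) (ξ : EN N → ℝ) (hR : 0 < R) (hx : 2 * R ≤ ‖x‖) (hM : 0 ≤ M)
    (hbM : ∀ z, |ξ z| ≤ M) (hsup : ∀ z, R ≤ ‖z‖ → ξ z = 0) :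
    |∫ z in {z : EN N | ‖x‖ / 2 ≤ dist x z},
        (ξ x - ξ z) * ‖z‖ ^ τ / dist x z ^ ((N:ℝ) + 2*s)| ≤
      (M * (1/2:ℝ) ^ (-((N:ℝ) + 2*s)) * (omegaN N * (R ^ (τ + N) / (τ + N)))) *
        ‖x‖ ^ (-((N:ℝ) + 2*s)) := by
  set q : ℝ := (N:ℝ) + 2*s with hq
  have hq0 : 0 < q := by positivity
  have hx0 : 0 < ‖x‖ := by linarith
  obtain ⟨i1, e1⟩ := rad1 N (by omega) τ R hτ1 hR.le
  have m1 : MeasurableSet {z : EN N | ‖z‖ ∈ Iio R} := measurable_norm measurableSet_Iio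
  have mS : MeasurableSet {z : EN N | ‖x‖ / 2 ≤ dist x z} :=
    (isClosed_le continuous_const (Continuous.dist continuous_const continuous_id)).measurableSet
  set G1 : EN N → ℝ := fun z => M * (‖x‖/2) ^ (-q) *
    {z : EN N | ‖z‖ ∈ Iio R}.indicator (fun z => ‖z‖ ^ τ) z with hG1
  have I1 : Integrable G1 := ((integrable_indicator_iff m1).2 i1).const_mul _
  have P1 : ∀ z, 0 ≤ G1 z := fun z => mul_nonneg (by positivity)
    (indicator_nonneg (fun z _ => by positivity) z)
  have hbound : ∀ z ∈ {z : EN N | ‖x‖ / 2 ≤ dist x z},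
      ‖(ξ x - ξ z) * ‖z‖ ^ τ / dist x z ^ q‖ ≤ G1 z := by
    intro z hz
    have hz : ‖x‖ / 2 ≤ dist x z := hz
    have hd : 0 < dist x z := by linarith
    rw [hsup x (by linarith)]
    rcases lt_or_ge ‖z‖ R with h | h
    · simp only [hG1]
      rw [indicator_of_mem (show z ∈ {z : EN N | ‖z‖ ∈ Iio R} from h)]
      have hτz : 0 ≤ ‖z‖ ^ τ := by positivity
      rw [norm_div, norm_mul, Real.norm_eq_abs, Real.norm_eq_abs, Real.norm_eq_abs,
        abs_of_nonneg hτz, abs_of_nonneg (by positivity : 0 ≤ dist x z ^ q), zero_sub, abs_neg,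
        mul_div_right_comm, div_eq_mul_inv, ← Real.rpow_neg hd.le]
      refine mul_le_mul_of_nonneg_right ?_ hτz
      exact mul_le_mul (hbM z) (Real.rpow_le_rpow_of_nonpos (by positivity) hz (by linarith))
        (by positivity) hM
    · rw [hsup z h]; simpa using P1 z
  have hae := (ae_restrict_iff' (μ := (volume : Measure (EN N))) mS).2 (ae_of_all _ hbound)
  have h1 := norm_integral_le_of_norm_le I1.integrableOn hae
  have h2 : ∫ z in {z : EN N | ‖x‖ / 2 ≤ dist x z}, G1 z ≤ ∫ z, G1 z :=
    setIntegral_le_integral I1 (ae_of_all _ P1)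
  rw [Real.norm_eq_abs] at h1
  refine (h1.trans h2).trans (le_of_eq ?_)
  simp only [hG1]
  rw [integral_const_mul, integral_indicator m1, e1,
    show ‖x‖/2 = 1/2 * ‖x‖ by ring, Real.mul_rpow (by norm_num) hx0.le]
  ring

lemma near_part (N : ℕ) (hN : 2 ≤ N) (s τ : ℝ) (hs1 : s < 1) :
    ∃ A : ℝ, 0 ≤ A ∧ ∀ (x : EN N) (K1 K2 : ℝ) (ξ : EN N → ℝ) (D : EN N →L[ℝ] ℝ), x ≠ 0 →
      0 ≤ K1 → 0 ≤ K2 → Continuous ξ → ‖D‖ ≤ K1 →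
      (∀ y : EN N, ‖y‖ < ‖x‖ / 2 → |ξ (x + y) - ξ x - D y| ≤ K2 * ‖y‖ ^ 2) →
      ∃ L : ℝ, Tendsto (fun ε : ℝ =>
        ∫ z in {z : EN N | ε ≤ dist x z ∧ dist x z < ‖x‖ / 2},
          (ξ x - ξ z) * ‖z‖ ^ τ / dist x z ^ ((N:ℝ) + 2*s)) (𝓝[>] 0) (𝓝 L) ∧
        (∀ ε : ℝ, 0 < ε → IntegrableOn (fun z : EN N =>
          (ξ x - ξ z) * ‖z‖ ^ τ / dist x z ^ ((N:ℝ) + 2*s))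
          {z : EN N | ε ≤ dist x z ∧ dist x z < ‖x‖ / 2}) ∧
        |L| ≤ A * (K2 * ‖x‖ ^ (2 - 2*s + τ) + K1 * ‖x‖ ^ (1 - 2*s + τ)) := by
  set q : ℝ := (N:ℝ) + 2*s with hq
  have hω := omegaN_nonneg N
  set c0 : ℝ := (1/2 : ℝ) ^ τ + (3/2 : ℝ) ^ τ with hc0
  set c1 : ℝ := |τ| * ((1/2 : ℝ) ^ (τ-1) + (3/2 : ℝ) ^ (τ-1)) with hc1
  have hc0p : 0 ≤ c0 := by positivity
  have hc1p : 0 ≤ c1 := by positivity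
  have h22 : 0 < 2 - 2*s := by linarith
  set W : ℝ := omegaN N * ((1/2:ℝ) ^ (2-2*s) / (2-2*s)) with hW
  have hWp : 0 ≤ W := by positivity
  refine ⟨(c0 + c1) * W, by positivity, ?_⟩
  intro x K1 K2 ξ D hx hK1 hK2 hξ hD hTay
  have hx0 : 0 < ‖x‖ := norm_pos_iff.2 hx
  set r : ℝ := ‖x‖ / 2 with hr
  have hr0 : 0 < r := by positivity
  set f : EN N → ℝ := fun z => (ξ x - ξ z) * ‖z‖ ^ τ / dist x z ^ q with hf
  set g : EN N → ℝ := fun y => D y * ‖x‖ ^ τ / ‖y‖ ^ q with hg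
  set h : EN N → ℝ := fun y => f (x + y) + g y with hh
  set B : ℝ := c0 * K2 * ‖x‖ ^ τ + c1 * K1 * ‖x‖ ^ (τ - 1) with hB
  have hB0 : 0 ≤ B := by positivity
  have hfm : Measurable f := wint_measurable N τ q ξ hξ x
  have hfm' : Measurable (fun y => f (x + y)) := hfm.comp (measurable_const_add x)
  have hgm : Measurable g := (D.continuous.measurable.mul_const _).div (measurable_norm.pow_const q)
  have hhm : Measurable h := hfm'.add hgm
  have hbound : ∀ y : EN N, ‖y‖ < r → ‖h y‖ ≤ B * ‖y‖ ^ (2 - q) := by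
    intro y hy
    rcases eq_or_ne y 0 with rfl | hy0
    · have : h 0 = 0 := by simp [hh, hf, hg]
      rw [this, norm_zero]
      positivity
    have hyp : 0 < ‖y‖ := norm_pos_iff.2 hy0
    have b1 : ‖x‖ / 2 ≤ ‖x + y‖ := by
      have : ‖x‖ ≤ ‖x + y‖ + ‖y‖ := by
        calc ‖x‖ = ‖(x + y) - y‖ := by congr 1; abel
          _ ≤ _ := norm_sub_le _ _
      linarith
    have b2 : ‖x + y‖ ≤ 3/2 * ‖x‖ := by linarith [norm_add_le x y]
    have b3 : |‖x + y‖ - ‖x‖| ≤ ‖y‖ := by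
      have := abs_norm_sub_norm_le (x + y) x
      simpa using this
    have p1 := pow_comp τ hx0 b1 b2
    have p2 := pow_diff τ hx0 b1 b2
    have hyq : 0 < ‖y‖ ^ q := by positivity
    have e : h y = (-((ξ (x + y) - ξ x - D y) * ‖x + y‖ ^ τ)
        - D y * (‖x + y‖ ^ τ - ‖x‖ ^ τ)) / ‖y‖ ^ q := by
      simp only [hh, hf, hg]
      rw [show dist x (x + y) = ‖y‖ by simp [dist_eq_norm]]
      ring
    rw [e, norm_div, Real.norm_eq_abs, Real.norm_eq_abs, abs_of_pos hyq, div_le_iff₀ hyq]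
    have e2 : B * ‖y‖ ^ (2 - q) * ‖y‖ ^ q = B * ‖y‖ ^ 2 := by
      rw [mul_assoc, ← Real.rpow_add hyp, sub_add_cancel]; norm_cast
    rw [e2]
    have hDy : |D y| ≤ K1 * ‖y‖ := by
      have := D.le_opNorm y
      rw [Real.norm_eq_abs] at this
      exact this.trans (mul_le_mul_of_nonneg_right hD (norm_nonneg _))
    calc |(-((ξ (x + y) - ξ x - D y) * ‖x + y‖ ^ τ) - D y * (‖x + y‖ ^ τ - ‖x‖ ^ τ))|
        ≤ |ξ (x + y) - ξ x - D y| * ‖x + y‖ ^ τ + |D y| * |‖x + y‖ ^ τ - ‖x‖ ^ τ| := by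
          refine (abs_sub _ _).trans (le_of_eq ?_)
          rw [abs_neg, abs_mul, abs_mul, abs_of_nonneg (by positivity : 0 ≤ ‖x + y‖ ^ τ)]
      _ ≤ (K2 * ‖y‖ ^ 2) * (c0 * ‖x‖ ^ τ) + (K1 * ‖y‖) * (c1 * ‖x‖ ^ (τ - 1) * ‖y‖) := by
          refine add_le_add (mul_le_mul (hTay y hy) p1 (by positivity) (by positivity))
            (mul_le_mul hDy (p2.trans ?_) (by positivity) (by positivity))
          exact mul_le_mul_of_nonneg_left b3 (by positivity)
      _ = B * ‖y‖ ^ 2 := by rw [hB]; ring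
  -- integrability of h on the ball
  obtain ⟨i1, e1⟩ := rad1 N (by omega) (2 - q) r (by rw [hq]; linarith) hr0.le
  have mB : MeasurableSet {z : EN N | ‖z‖ ∈ Iio r} := measurable_norm measurableSet_Iio
  have iB : IntegrableOn (fun y : EN N => B * ‖y‖ ^ (2 - q)) {z : EN N | ‖z‖ ∈ Iio r} :=
    i1.const_mul B
  have hae := (ae_restrict_iff' (μ := (volume : Measure (EN N))) mB).2
    (ae_of_all _ (fun y hy => hbound y hy))
  have ih : IntegrableOn h {z : EN N | ‖z‖ ∈ Iio r} :=
    Integrable.mono' iB hhm.aestronglyMeasurable hae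
  have mT : ∀ ε : ℝ, MeasurableSet {z : EN N | ‖z‖ ∈ Ico ε r} :=
    fun ε => measurable_norm measurableSet_Ico
  have hsub : ∀ ε : ℝ, {z : EN N | ‖z‖ ∈ Ico ε r} ⊆ {z : EN N | ‖z‖ ∈ Iio r} :=
    fun ε z hz => hz.2
  have ig : ∀ ε : ℝ, 0 < ε → IntegrableOn g {z : EN N | ‖z‖ ∈ Ico ε r} := by
    intro ε hε
    rcases le_or_gt ε r with hεr | hεr
    swap
    · rw [Ico_eq_empty_of_le hεr.le]; simp
    have i3 := (rad3 N (by omega) (1 - q) ε r hε hεr).1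
    refine Integrable.mono' (i3.const_mul (K1 * ‖x‖ ^ τ)) hgm.aestronglyMeasurable ?_
    refine (ae_restrict_iff' (mT ε)).2 (ae_of_all _ fun y hy => ?_)
    have hyp : 0 < ‖y‖ := lt_of_lt_of_le hε hy.1
    have hDy : |D y| ≤ K1 * ‖y‖ := by
      have := D.le_opNorm y
      rw [Real.norm_eq_abs] at this
      exact this.trans (mul_le_mul_of_nonneg_right hD (norm_nonneg _))
    have hyq : 0 < ‖y‖ ^ q := by positivity
    simp only [hg]
    rw [norm_div, norm_mul, Real.norm_eq_abs, Real.norm_eq_abs, Real.norm_eq_abs, abs_of_pos hyq,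
      abs_of_nonneg (by positivity : 0 ≤ ‖x‖ ^ τ), div_le_iff₀ hyq, mul_assoc,
      ← Real.rpow_add hyp, sub_add_cancel, Real.rpow_one]
    calc |D y| * ‖x‖ ^ τ ≤ (K1 * ‖y‖) * ‖x‖ ^ τ :=
          mul_le_mul_of_nonneg_right hDy (by positivity)
      _ = _ := by ring
  have ig0 : ∀ ε : ℝ, ∫ y in {z : EN N | ‖z‖ ∈ Ico ε r}, g y = 0 := by
    intro ε
    rw [← integral_indicator (mT ε)]
    have h1 := integral_neg_eq_self ({z : EN N | ‖z‖ ∈ Ico ε r}.indicator g) volume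
    have h2 : ∀ y, {z : EN N | ‖z‖ ∈ Ico ε r}.indicator g (-y)
        = - {z : EN N | ‖z‖ ∈ Ico ε r}.indicator g y := by
      intro y
      by_cases hy : y ∈ {z : EN N | ‖z‖ ∈ Ico ε r}
      · have hy' : -y ∈ {z : EN N | ‖z‖ ∈ Ico ε r} := by simpa using hy
        rw [indicator_of_mem hy, indicator_of_mem hy']
        simp [hg, neg_div]
      · have hy' : -y ∉ {z : EN N | ‖z‖ ∈ Ico ε r} := by simpa using hy
        rw [indicator_of_notMem hy, indicator_of_notMem hy', neg_zero]
    simp only [h2] at h1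
    rw [integral_neg] at h1
    linarith
  have ifx : ∀ ε : ℝ, 0 < ε → IntegrableOn (fun y => f (x + y)) {z : EN N | ‖z‖ ∈ Ico ε r} := by
    intro ε hε
    have := (ih.mono_set (hsub ε)).sub (ig ε hε)
    refine this.congr (ae_of_all _ fun y => ?_)
    simp [hh]
  have hind : ∀ ε : ℝ, ∀ y, {z : EN N | ε ≤ dist x z ∧ dist x z < r}.indicator f (x + y)
      = {z : EN N | ‖z‖ ∈ Ico ε r}.indicator (fun y => f (x + y)) y := by
    intro ε y
    simp [indicator, dist_eq_norm]
  have mS : ∀ ε : ℝ, MeasurableSet {z : EN N | ε ≤ dist x z ∧ dist x z < r} := by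
    intro ε
    have : Measurable (fun z : EN N => dist x z) :=
      (Continuous.dist continuous_const continuous_id).measurable
    exact this measurableSet_Ico
  have hI : ∀ ε : ℝ, 0 < ε → ∫ z in {z : EN N | ε ≤ dist x z ∧ dist x z < r}, f z
      = ∫ y in {z : EN N | ‖z‖ ∈ Ico ε r}, h y := by
    intro ε hε
    rw [← integral_indicator (mS ε), ← integral_add_left_eq_self _ x]
    simp only [hind]
    rw [integral_indicator (mT ε)]
    simp only [hh]
    rw [integral_add (ifx ε hε) (ig ε hε), ig0, add_zero]
  refine ⟨∫ y in {z : EN N | ‖z‖ ∈ Iio r}, h y, ?_, ?_, ?_⟩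
  · have : Tendsto (fun ε : ℝ => ∫ y in {z : EN N | ‖z‖ ∈ Ico ε r}, h y) (𝓝[>] 0)
        (𝓝 (∫ y in {z : EN N | ‖z‖ ∈ Iio r}, h y)) := by
      simp only [← integral_indicator (mT _), ← integral_indicator mB]
      refine tendsto_integral_filter_of_dominated_convergence
        ({z : EN N | ‖z‖ ∈ Iio r}.indicator (fun y => B * ‖y‖ ^ (2 - q))) ?_ ?_
        ((integrable_indicator_iff mB).2 iB) ?_
      · exact Eventually.of_forall fun ε => (hhm.indicator (mT ε)).aestronglyMeasurable
      · refine Eventually.of_forall fun ε => ae_of_all _ fun y => ?_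
        by_cases hy : y ∈ {z : EN N | ‖z‖ ∈ Iio r}
        · rw [indicator_of_mem hy]
          refine le_trans ?_ (hbound y hy)
          exact norm_indicator_le_norm_self _ _
        · have hy' : y ∉ {z : EN N | ‖z‖ ∈ Ico ε r} := fun h => hy (hsub ε h)
          rw [indicator_of_notMem hy, indicator_of_notMem hy', norm_zero]
      · refine ae_of_all _ fun y => ?_
        rcases eq_or_ne y 0 with rfl | hy0
        · have h0 : h 0 = 0 := by simp [hh, hf, hg]
          have : ∀ S : Set (EN N), S.indicator h 0 = 0 := fun S => by
            by_cases hS : (0 : EN N) ∈ S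
            · rw [indicator_of_mem hS, h0]
            · rw [indicator_of_notMem hS]
          simp only [this]
          exact tendsto_const_nhds
        · have hyp : 0 < ‖y‖ := norm_pos_iff.2 hy0
          refine tendsto_const_nhds.congr' ?_
          filter_upwards [Ioo_mem_nhdsGT hyp] with ε hε
          have : ε ≤ ‖y‖ := hε.2.le
          simp [indicator, this]
    refine this.congr' ?_
    filter_upwards [self_mem_nhdsWithin] with ε hε
    exact (hI ε hε).symm
  · intro ε hε
    rw [← integrable_indicator_iff (mS ε)]
    have := (integrable_indicator_iff (mT ε)).2 (ifx ε hε)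
    have h2 := (integrable_congr (ae_of_all volume (hind ε))).2 this
    have h3 := h2.comp_add_left (-x)
    simpa using h3
  · have h1 := norm_integral_le_of_norm_le iB hae
    rw [integral_const_mul, e1, Real.norm_eq_abs] at h1
    refine h1.trans ?_
    rw [show 2 - q + N = 2 - 2*s by rw [hq]; ring, hr, show ‖x‖/2 = 1/2 * ‖x‖ by ring,
      Real.mul_rpow (by norm_num) hx0.le]
    have e2 : B * ‖x‖ ^ (2 - 2*s) = c0 * (K2 * ‖x‖ ^ (2 - 2*s + τ))
        + c1 * (K1 * ‖x‖ ^ (1 - 2*s + τ)) := by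
      rw [hB, Real.rpow_add hx0, show 1 - 2*s + τ = (2 - 2*s) + (τ - 1) by ring,
        Real.rpow_add hx0 (2 - 2*s) (τ - 1)]
      ring
    have e3 : B * (omegaN N * ((1/2:ℝ) ^ (2-2*s) * ‖x‖ ^ (2-2*s) / (2-2*s)))
        = W * (B * ‖x‖ ^ (2 - 2*s)) := by rw [hW]; ring
    rw [e3, e2]
    have n1 : 0 ≤ W * (K2 * ‖x‖ ^ (2 - 2*s + τ)) := by positivity
    have n2 : 0 ≤ W * (K1 * ‖x‖ ^ (1 - 2*s + τ)) := by positivity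
    nlinarith [mul_nonneg hc0p n2, mul_nonneg hc1p n1]

lemma lam_bound (N : ℕ) (hN : 2 ≤ N) (s τ T : ℝ) (hs0 : 0 < s) (hτ1 : 0 < τ + N) (hT : 1 ≤ T) :
    ∃ B : ℝ, 0 ≤ B ∧ ∀ x : EN N, x ≠ 0 → ‖x‖ ≤ T →
      0 ≤ Lam N s τ x ∧ ‖x‖ ^ (1 - 2*s + τ) ≤ B * Lam N s τ x ∧
      (∫ t in ‖x‖..T, t ^ (τ - 2*s)) ≤ B * Lam N s τ x ∧ 1 ≤ B * Lam N s τ x ∧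
      Lam N s τ x ≤ B * ‖x‖ ^ (-((N:ℝ) + 2*s)) := by
  have hN' : (2:ℝ) ≤ N := by exact_mod_cast hN
  have hT0 : 0 < T := by linarith
  set q : ℝ := (N:ℝ) + 2*s with hq
  set σ : ℝ := 1 - 2*s + τ with hσ
  have hq0 : 0 < q := by positivity
  have h0 : ∀ a : ℝ, 0 < a → a ≤ T → (0:ℝ) ∉ Set.uIcc a T := fun a ha haT => by
    rw [uIcc_of_le haT]; intro h; linarith [h.1]
  have key : ∀ (a p : ℝ), 0 < a → a ≤ T → 0 ≤ p + q → a ^ p ≤ T ^ (p + q) * a ^ (-q) := by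
    intro a p ha haT hp
    have : a ^ p = a ^ (p + q) * a ^ (-q) := by
      rw [← Real.rpow_add ha]; congr 1; ring
    rw [this]
    exact mul_le_mul_of_nonneg_right (Real.rpow_le_rpow ha.le haT hp) (by positivity)
  rcases lt_trichotomy (2*s - 1) τ with h | h | h
  · have hσ0 : 0 < σ := by rw [hσ]; linarith
    refine ⟨T ^ σ + T ^ σ / σ + 1 + T ^ q, by positivity, fun x hx hxT => ?_⟩
    have hx0 : 0 < ‖x‖ := norm_pos_iff.2 hx
    have hL : Lam N s τ x = 1 := by simp [Lam, h]
    have k := key ‖x‖ 0 hx0 hxT (by linarith)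
    rw [Real.rpow_zero, zero_add] at k
    have p1 : 0 ≤ T ^ σ := by positivity
    have p2 : 0 ≤ T ^ σ / σ := by positivity
    have p3 : 0 ≤ T ^ q := by positivity
    have p4 : 0 ≤ ‖x‖ ^ (-q) := by positivity
    rw [hL, mul_one]
    refine ⟨zero_le_one, ?_, ?_, by linarith, ?_⟩
    · have := Real.rpow_le_rpow hx0.le hxT hσ0.le
      linarith
    · rw [integral_rpow (Or.inl (by linarith)), show τ - 2*s + 1 = σ by rw [hσ]; ring, sub_div]
      have : 0 ≤ ‖x‖ ^ σ / σ := by positivity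
      linarith
    · refine k.trans (mul_le_mul_of_nonneg_right (by linarith) p4)
  · have hσ0 : σ = 0 := by rw [hσ]; linarith
    have hlT : 0 ≤ Real.log T := Real.log_nonneg hT
    refine ⟨1 + Real.log T + T ^ q + T ^ (-1 + q), by positivity, fun x hx hxT => ?_⟩
    have hx0 : 0 < ‖x‖ := norm_pos_iff.2 hx
    have hL : Lam N s τ x = 1 + max (-Real.log ‖x‖) 0 := by
      simp [Lam, h]
    have k := key ‖x‖ 0 hx0 hxT (by linarith)
    have k1 := key ‖x‖ (-1) hx0 hxT (by linarith)
    rw [Real.rpow_zero, zero_add] at k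
    rw [Real.rpow_neg_one] at k1
    have p3 : 0 ≤ T ^ q := by positivity
    have p5 : 0 ≤ T ^ (-1 + q) := by positivity
    have p4 : 0 ≤ ‖x‖ ^ (-q) := by positivity
    have m0 := le_max_right (-Real.log ‖x‖) 0
    have m1 := le_max_left (-Real.log ‖x‖) 0
    have hL1 : 1 ≤ Lam N s τ x := by rw [hL]; linarith
    have hBL : 1 + Real.log T + max (-Real.log ‖x‖) 0 ≤
        (1 + Real.log T + T ^ q + T ^ (-1 + q)) * Lam N s τ x := by
      have : 1 + Real.log T + max (-Real.log ‖x‖) 0 ≤ (1 + Real.log T) * Lam N s τ x := by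
        rw [hL]; nlinarith
      refine this.trans (mul_le_mul_of_nonneg_right (by linarith) (by linarith))
    refine ⟨by linarith, ?_, ?_, by linarith, ?_⟩
    · rw [hσ0, Real.rpow_zero]; linarith
    · have e : ∫ t in ‖x‖..T, t ^ (τ - 2*s) = ∫ t in ‖x‖..T, t⁻¹ := by
        rw [show τ - 2*s = -1 by linarith]
        simp only [Real.rpow_neg_one]
      rw [e, integral_inv (h0 _ hx0 hxT), Real.log_div hT0.ne' hx0.ne']
      linarith
    · have hl : -Real.log ‖x‖ ≤ ‖x‖⁻¹ := by
        rw [← Real.log_inv]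
        have := Real.log_le_sub_one_of_pos (inv_pos.2 hx0)
        linarith
      have hm : max (-Real.log ‖x‖) 0 ≤ ‖x‖⁻¹ := max_le hl (by positivity)
      rw [hL]
      have : 0 ≤ (1 + Real.log T) * ‖x‖ ^ (-q) := by positivity
      nlinarith
  · have hσ0 : σ < 0 := by rw [hσ]; linarith
    have hσ1 : 0 < -σ := by linarith
    refine ⟨1 + 1 / (-σ) + T ^ (-σ) + T ^ (σ + q), by positivity, fun x hx hxT => ?_⟩
    have hx0 : 0 < ‖x‖ := norm_pos_iff.2 hx
    have hL : Lam N s τ x = ‖x‖ ^ σ := by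
      simp [Lam, h, not_lt.2 h.le, hσ]
    have k := key ‖x‖ σ hx0 hxT (by rw [hσ, hq]; linarith)
    have p0 : 0 ≤ ‖x‖ ^ σ := by positivity
    have p1 : 0 ≤ 1 / (-σ) := by positivity
    have p2 : 0 ≤ T ^ (-σ) := by positivity
    have p3 : 0 ≤ T ^ (σ + q) := by positivity
    have p4 : 0 ≤ ‖x‖ ^ (-q) := by positivity
    rw [hL]
    refine ⟨p0, ?_, ?_, ?_, ?_⟩
    · exact le_mul_of_one_le_left p0 (by linarith)
    · rw [integral_rpow (Or.inr ⟨by intro h'; linarith, h0 _ hx0 hxT⟩),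
        show τ - 2*s + 1 = σ by rw [hσ]; ring]
      have e : (T ^ σ - ‖x‖ ^ σ) / σ = 1 / (-σ) * ‖x‖ ^ σ - 1 / (-σ) * T ^ σ := by
        field_simp; ring
      have : 0 ≤ 1 / (-σ) * T ^ σ := by positivity
      rw [e]
      have : 1 / (-σ) * ‖x‖ ^ σ ≤ (1 + 1 / (-σ) + T ^ (-σ) + T ^ (σ + q)) * ‖x‖ ^ σ :=
        mul_le_mul_of_nonneg_right (by linarith) p0
      linarith
    · have : 1 ≤ T ^ (-σ) * ‖x‖ ^ σ := by
        have := Real.rpow_le_rpow_of_nonpos hx0 hxT hσ0.le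
        calc (1:ℝ) = T ^ (-σ) * T ^ σ := by rw [← Real.rpow_add hT0]; simp
          _ ≤ _ := mul_le_mul_of_nonneg_left this p2
      exact this.trans (mul_le_mul_of_nonneg_right (by linarith) p0)
    · exact k.trans (mul_le_mul_of_nonneg_right (by linarith) p4)

lemma lam_large (N : ℕ) (s τ : ℝ) (hs0 : 0 < s) (hτ1 : 0 < τ + N) (x : EN N) (hx : 1 ≤ ‖x‖) :
    ‖x‖ ^ (-((N:ℝ) + 2*s)) ≤ Lam N s τ x := by
  have h1 : ‖x‖ ^ (-((N:ℝ) + 2*s)) ≤ 1 :=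
    Real.rpow_le_one_of_one_le_of_nonpos hx (by
      have : (0:ℝ) ≤ N := Nat.cast_nonneg N
      linarith)
  unfold Lam
  split_ifs with h h'
  · exact h1
  · exact Real.rpow_le_rpow_of_exponent_le hx (by linarith)
  · linarith [le_max_right (-Real.log ‖x‖) 0]

lemma wlap_combine (N : ℕ) (s τ : ℝ) (x : EN N) (hx : x ≠ 0) (ξ : EN N → ℝ) (L : ℝ)
    (hL : Tendsto (fun ε : ℝ =>
        ∫ z in {z : EN N | ε ≤ dist x z ∧ dist x z < ‖x‖ / 2},
          (ξ x - ξ z) * ‖z‖ ^ τ / dist x z ^ ((N:ℝ) + 2*s)) (𝓝[>] 0) (𝓝 L))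
    (hi : ∀ ε : ℝ, 0 < ε → IntegrableOn (fun z : EN N =>
          (ξ x - ξ z) * ‖z‖ ^ τ / dist x z ^ ((N:ℝ) + 2*s))
          {z : EN N | ε ≤ dist x z ∧ dist x z < ‖x‖ / 2})
    (hf : IntegrableOn (fun z : EN N => (ξ x - ξ z) * ‖z‖ ^ τ / dist x z ^ ((N:ℝ) + 2*s))
        {z | ‖x‖ / 2 ≤ dist x z}) :
    HasWFracLap N s τ ξ x (CNs N s * (L + ∫ z in {z : EN N | ‖x‖ / 2 ≤ dist x z},
        (ξ x - ξ z) * ‖z‖ ^ τ / dist x z ^ ((N:ℝ) + 2*s))) := by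
  have hx0 : 0 < ‖x‖ := norm_pos_iff.2 hx
  refine Tendsto.const_mul _ ((hL.add_const _).congr' ?_)
  filter_upwards [Ioo_mem_nhdsGT (half_pos hx0)] with ε hε
  have hset : {z : EN N | ε ≤ dist x z} =
      {z : EN N | ε ≤ dist x z ∧ dist x z < ‖x‖ / 2} ∪ {z | ‖x‖ / 2 ≤ dist x z} := by
    ext z
    simp only [mem_setOf_eq, mem_union]
    have := hε.2
    constructor
    · intro h
      rcases lt_or_ge (dist x z) (‖x‖/2) with h' | h'
      · exact Or.inl ⟨h, h'⟩
      · exact Or.inr h'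
    · rintro (h | h)
      · exact h.1
      · linarith
  have mS : MeasurableSet {z : EN N | ‖x‖ / 2 ≤ dist x z} :=
    (isClosed_le continuous_const (Continuous.dist continuous_const continuous_id)).measurableSet
  rw [hset, setIntegral_union _ mS (hi ε hε.1) hf]
  rw [Set.disjoint_left]
  intro z hz hz'
  exact absurd hz.2 (not_lt.2 hz')

/-- Proposition 1.5: pointwise estimate
`|(-Δ)^s_{Γ_μ} ξ (x)| ≤ c₀ min { Λ_μ(x), |x|^{-N-2s} }` for `ξ ∈ C²_c(ℝ^N)`. -/
theorem weighted_fractional_laplacian_estimate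
    (N : ℕ) (hN : 2 ≤ N) (s : ℝ) (hs : s ∈ Ioo (0:ℝ) 1)
    (μ τp : ℝ) (hμ : mu0 N s ≤ μ)
    (hτp : τp ∈ Ico ((2*s - N)/2) (2*s)) (hτpc : csFun N s τp = -μ) :
    ∀ ξ : EN N → ℝ, ContDiff ℝ 2 ξ → HasCompactSupport ξ →
      ∃ c0 : ℝ, 0 < c0 ∧
        ∀ x : EN N, x ≠ 0 →
          ∃ L : ℝ, HasWFracLap N s τp ξ x L ∧
            |L| ≤ c0 * min (Lam N s τp x) (‖x‖ ^ (-((N:ℝ) + 2*s))) := by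
  intro ξ hξ hc
  obtain ⟨hs0, hs1⟩ := hs
  obtain ⟨hτa, hτ2⟩ := hτp
  have hN' : (2:ℝ) ≤ N := by exact_mod_cast hN
  have hτ1 : 0 < τp + N := by linarith
  have hcont : Continuous ξ := hξ.continuous
  have hdiff : Differentiable ℝ ξ := hξ.differentiable (by norm_num)
  -- constants attached to ξ
  obtain ⟨K, hK⟩ := ContDiff.lipschitzWith_of_hasCompactSupport hc hξ (by norm_num)
  have hfd : ContDiff ℝ 1 (fderiv ℝ ξ) := hξ.fderiv_right (by norm_num)
  obtain ⟨K2, hK2⟩ := ContDiff.lipschitzWith_of_hasCompactSupport (hc.fderiv (𝕜 := ℝ)) hfd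
    (by norm_num)
  obtain ⟨M, hM⟩ := hc.exists_bound_of_continuous hcont
  simp only [Real.norm_eq_abs] at hM
  have hM0 : 0 ≤ M := (abs_nonneg _).trans (hM 0)
  obtain ⟨R, hR1, hRs⟩ : ∃ R : ℝ, 1 ≤ R ∧ ∀ z : EN N, R ≤ ‖z‖ → ξ z = 0 := by
    obtain ⟨R, hR⟩ := hc.isBounded.subset_closedBall 0
    refine ⟨max 1 (R + 1), le_max_left _ _, fun z hz => ?_⟩
    by_contra h
    have := hR (subset_tsupport _ (Function.mem_support.2 h))
    rw [mem_closedBall_zero_iff] at this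
    linarith [le_max_right 1 (R + 1)]
  have hlip : ∀ x z, |ξ x - ξ z| ≤ K * dist x z := fun x z => by
    have := hK.dist_le_mul x z
    rwa [Real.dist_eq] at this
  have hbM : ∀ x z, |ξ x - ξ z| ≤ 2 * M := fun x z =>
    (abs_sub _ _).trans (by linarith [hM x, hM z])
  have hD : ∀ x, ‖fderiv ℝ ξ x‖ ≤ K := fun x => norm_fderiv_le_of_lipschitz ℝ hK
  have hTay : ∀ x y : EN N, |ξ (x + y) - ξ x - fderiv ℝ ξ x y| ≤ K2 * ‖y‖ ^ 2 := by
    intro x y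
    have := Convex.norm_image_sub_le_of_norm_fderiv_le' (𝕜 := ℝ) (f := ξ) (C := K2 * ‖y‖)
      (φ := fderiv ℝ ξ x) (s := closedBall x ‖y‖) (x := x) (y := x + y)
      (fun z _ => hdiff z) (fun z hz => by
        have h1 := hK2.dist_le_mul z x
        rw [dist_eq_norm] at h1
        exact h1.trans (mul_le_mul_of_nonneg_left (mem_closedBall.1 hz) K2.2))
      (convex_closedBall _ _) (mem_closedBall_self (norm_nonneg _)) (by simp)
    rw [add_sub_cancel_left, Real.norm_eq_abs] at this
    calc _ ≤ _ := this
      _ = _ := by ring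
  obtain ⟨An, hAn, near⟩ := near_part N hN s τp hs1
  obtain ⟨Af, hAf, far⟩ := far_bound N hN s τp hs0 hτ1 hτ2
  obtain ⟨B, hB, lam⟩ := lam_bound N hN s τp (2 * R) hs0 hτ1 (by linarith)
  set q : ℝ := (N:ℝ) + 2*s with hq
  set C1 : ℝ := |CNs N s| * ((An * (K2 * (2 * R) + K)
    + Af * (K + K + 2 * M * (2 * R) ^ (τp - 2*s))) * B) with hC1
  set C2 : ℝ := |CNs N s| *
    (M * (1/2:ℝ) ^ (-q) * (omegaN N * (R ^ (τp + N) / (τp + N)))) with hC2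
  have hR0 : 0 < R := by linarith
  have hω := omegaN_nonneg N
  have hC1p : 0 ≤ C1 := by positivity
  have hC2p : 0 ≤ C2 := by positivity
  refine ⟨C1 + C1 * B + C2 + 1, by positivity, fun x hx => ?_⟩
  have hx0 : 0 < ‖x‖ := norm_pos_iff.2 hx
  have hxq : 0 ≤ ‖x‖ ^ (-q) := by positivity
  rcases le_or_gt ‖x‖ (2 * R) with hxR | hxR
  · obtain ⟨L, hL, hi, hLb⟩ := near x K K2 ξ (fderiv ℝ ξ x) hx K.2 K2.2 hcont (hD x)
      (fun y _ => hTay x y)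
    obtain ⟨hf, hfb⟩ := far x (2 * R) (2 * M) K ξ hx hxR (by positivity) K.2 hcont (hbM x) (hlip x)
    obtain ⟨l0, l1, l2, l3, l4⟩ := lam x hx hxR
    refine ⟨_, wlap_combine N s τp x hx ξ L hL hi hf, ?_⟩
    set Λ := Lam N s τp x with hΛ
    set F := ∫ z in {z : EN N | ‖x‖ / 2 ≤ dist x z},
        (ξ x - ξ z) * ‖z‖ ^ τp / dist x z ^ q with hF
    have hP' : ‖x‖ ^ (2 - 2*s + τp) ≤ (2 * R) * (B * Λ) := by
      rw [show 2 - 2*s + τp = 1 + (1 - 2*s + τp) by ring, Real.rpow_add hx0, Real.rpow_one]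
      exact mul_le_mul hxR l1 (by positivity) (by positivity)
    have hKp : (0:ℝ) ≤ K := K.2
    have hK2p : (0:ℝ) ≤ K2 := K2.2
    have g1 : |L| ≤ An * (K2 * ((2 * R) * (B * Λ)) + K * (B * Λ)) :=
      hLb.trans (mul_le_mul_of_nonneg_left (add_le_add (mul_le_mul_of_nonneg_left hP' hK2p)
        (mul_le_mul_of_nonneg_left l1 hKp)) hAn)
    have g2 : |F| ≤ Af * (K * (B * Λ) + K * (B * Λ)
        + 2 * M * (2 * R) ^ (τp - 2*s) * (B * Λ)) := by
      refine hfb.trans (mul_le_mul_of_nonneg_left (add_le_add (add_le_add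
        (mul_le_mul_of_nonneg_left l1 hKp) (mul_le_mul_of_nonneg_left l2 hKp)) ?_) hAf)
      exact le_mul_of_one_le_right (by positivity) l3
    have g3 : |CNs N s * (L + F)| ≤ C1 * Λ := by
      rw [abs_mul]
      calc |CNs N s| * |L + F| ≤ |CNs N s| * (An * (K2 * ((2 * R) * (B * Λ)) + K * (B * Λ))
            + Af * (K * (B * Λ) + K * (B * Λ) + 2 * M * (2 * R) ^ (τp - 2*s) * (B * Λ))) :=
            mul_le_mul_of_nonneg_left ((abs_add_le _ _).trans (add_le_add g1 g2)) (abs_nonneg _)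
        _ = C1 * Λ := by rw [hC1]; ring
    have hC1B : 0 ≤ C1 * B := by positivity
    rw [mul_min_of_nonneg _ _ (by positivity)]
    refine le_min (g3.trans (mul_le_mul_of_nonneg_right (by linarith) l0)) ?_
    calc _ ≤ C1 * Λ := g3
      _ ≤ C1 * (B * ‖x‖ ^ (-q)) := mul_le_mul_of_nonneg_left l4 hC1p
      _ = C1 * B * ‖x‖ ^ (-q) := by ring
      _ ≤ _ := mul_le_mul_of_nonneg_right (by linarith) hxq
  · have hzero : ∀ y : EN N, ‖y‖ < ‖x‖ / 2 →
        |ξ (x + y) - ξ x - (0 : EN N →L[ℝ] ℝ) y| ≤ 0 * ‖y‖ ^ 2 := by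
      intro y hy
      have : ‖x‖ ≤ ‖x + y‖ + ‖y‖ := by
        calc ‖x‖ = ‖(x + y) - y‖ := by congr 1; abel
          _ ≤ _ := norm_sub_le _ _
      rw [hRs (x + y) (by linarith), hRs x (by linarith)]
      simp
    obtain ⟨L, hL, hi, hLb⟩ := near x 0 0 ξ 0 hx le_rfl le_rfl hcont (by simp) hzero
    obtain ⟨hf, -⟩ := far x ‖x‖ (2 * M) K ξ hx le_rfl (by positivity) K.2 hcont (hbM x) (hlip x)
    have hL0 : L = 0 := by
      rw [zero_mul, zero_mul, add_zero, mul_zero] at hLb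
      exact abs_nonpos_iff.1 hLb
    have hfl := far_large N hN s τp hs0 hτ1 x R M ξ hR0 hxR.le hM0 hM hRs
    refine ⟨_, wlap_combine N s τp x hx ξ L hL hi hf, ?_⟩
    have hll := lam_large N s τp hs0 hτ1 x (by linarith)
    rw [min_eq_right hll, hL0, zero_add, abs_mul]
    have hC1B : 0 ≤ C1 * B := by positivity
    calc _ ≤ |CNs N s| * _ := mul_le_mul_of_nonneg_left hfl (abs_nonneg _)
      _ = C2 * ‖x‖ ^ (-q) := by rw [hC2]; ring
      _ ≤ _ := mul_le_mul_of_nonneg_right (by linarith) hxq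
end
end

section
/- Let N ≥ 2, s ∈ (0,1), and τ ∈ (−N, 2s) with τ ∉ {0, 2s−N}. Then for every x ∈ ℝ^N∖{0} the principal value limit defining (−Δ)^s |·|^τ (x) exists and (−Δ)^s |·|^τ (x) = c_s(τ) |x|^{τ−2s}. Moreover, for τ ∈ {0, 2s−N} and every x ∈ ℝ^N∖{0}, the principal value limit exists and (−Δ)^s |·|^τ (x) = 0. -/
open MeasureTheory Filter Set Topology Metric

noncomputable section

lemma gam_int {a r : ℝ} (ha : 0 < a) (hr : 0 < r) :
    IntegrableOn (fun t : ℝ => t ^ (a - 1) * Real.exp (-(r * t))) (Ioi 0) := by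
  have := integrableOn_rpow_mul_exp_neg_mul_rpow (p := 1) (s := a - 1) (b := r)
    (by linarith) one_pos hr
  simpa using this

lemma laplace_le {σ a b : ℝ} (hσ : σ < 1) (hσ0 : σ ≠ 0) (ha : 0 < a) (hab : a ≤ b) :
    IntegrableOn (fun t : ℝ => t ^ (-σ - 1) * (Real.exp (-(t * a)) - Real.exp (-(t * b)))) (Ioi 0) ∧
    ∫ t in Ioi (0:ℝ), t ^ (-σ - 1) * (Real.exp (-(t * a)) - Real.exp (-(t * b)))
      = Real.Gamma (-σ) * (a ^ σ - b ^ σ) := by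
  have key : ∀ t ∈ Ioi (0:ℝ), ∫ l in Ioc a b, t ^ ((1 - σ) - 1) * Real.exp (-(l * t))
      = t ^ (-σ - 1) * (Real.exp (-(t * a)) - Real.exp (-(t * b))) := by
    intro t ht
    have ht' : (0:ℝ) < t := ht
    rw [← intervalIntegral.integral_of_le hab]
    have hd : ∀ l ∈ uIcc a b, HasDerivAt (fun l : ℝ => -(t ^ (-σ - 1) * Real.exp (-(l * t))))
        (t ^ ((1 - σ) - 1) * Real.exp (-(l * t))) l := by
      intro l _
      have h1 : HasDerivAt (fun l : ℝ => -(l * t)) (-t) l := by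
        exact ((hasDerivAt_id l).mul_const t).neg.congr_deriv (by simp)
      have h2 := (h1.exp.const_mul (t ^ (-σ - 1))).neg
      refine h2.congr_deriv ?_
      have : t ^ ((1 - σ) - 1) = t ^ (-σ - 1) * t := by
        rw [← Real.rpow_add_one ht'.ne']; congr 1; ring
      rw [this]; ring
    rw [intervalIntegral.integral_eq_sub_of_hasDerivAt hd]
    · rw [mul_comm a t, mul_comm b t]; ring
    · apply Continuous.intervalIntegrable; fun_prop
  have hmeas : AEStronglyMeasurable
      (fun p : ℝ × ℝ => p.1 ^ ((1 - σ) - 1) * Real.exp (-(p.2 * p.1)))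
      ((volume.restrict (Ioi (0:ℝ))).prod (volume.restrict (Ioc a b))) := by
    apply Measurable.aestronglyMeasurable; fun_prop
  have hval : ∀ l ∈ Ioc a b, ∫ t in Ioi (0:ℝ), t ^ ((1 - σ) - 1) * Real.exp (-(l * t))
      = l ^ (σ - 1) * Real.Gamma (1 - σ) := by
    intro l hl
    have hl0 : 0 < l := ha.trans hl.1
    rw [Real.integral_rpow_mul_exp_neg_mul_Ioi (by linarith) hl0, one_div,
      Real.inv_rpow hl0.le, ← Real.rpow_neg hl0.le]
    congr 2; ring
  have hcont : ContinuousOn (fun l : ℝ => l ^ (σ - 1) * Real.Gamma (1 - σ)) (Icc a b) := by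
    apply ContinuousOn.mul _ continuousOn_const
    apply ContinuousOn.rpow_const continuousOn_id
    intro l hl; left; exact (ha.trans_le hl.1).ne'
  have hprod : Integrable (fun p : ℝ × ℝ => p.1 ^ ((1 - σ) - 1) * Real.exp (-(p.2 * p.1)))
      ((volume.restrict (Ioi (0:ℝ))).prod (volume.restrict (Ioc a b))) := by
    rw [integrable_prod_iff' hmeas]
    constructor
    · filter_upwards [ae_restrict_mem measurableSet_Ioc] with l hl
      exact gam_int (by linarith) (ha.trans hl.1)
    · have : IntegrableOn (fun l : ℝ => l ^ (σ - 1) * Real.Gamma (1 - σ)) (Ioc a b) :=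
        (hcont.integrableOn_Icc).mono_set Ioc_subset_Icc_self
      refine this.congr ?_
      filter_upwards [ae_restrict_mem measurableSet_Ioc] with l hl
      rw [← hval l hl]
      apply setIntegral_congr_fun measurableSet_Ioi
      intro t ht
      have ht' : (0:ℝ) < t := ht
      simp only [Real.norm_eq_abs]
      rw [abs_of_nonneg]; positivity
  constructor
  · refine (hprod.integral_prod_left).congr ?_
    filter_upwards [ae_restrict_mem measurableSet_Ioi] with t ht
    exact key t ht
  · rw [← setIntegral_congr_fun measurableSet_Ioi key]
    rw [integral_integral_swap (f := fun t l : ℝ => t ^ ((1 - σ) - 1) * Real.exp (-(l * t))) hprod]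
    rw [setIntegral_congr_fun measurableSet_Ioc hval]
    rw [integral_mul_const, ← intervalIntegral.integral_of_le hab, integral_rpow]
    · have : Real.Gamma (1 - σ) = -σ * Real.Gamma (-σ) := by
        rw [← Real.Gamma_add_one (by simpa using hσ0)]; congr 1; ring
      rw [this]; simp only [sub_add_cancel]; field_simp; ring
    · right
      refine ⟨by intro h; apply hσ0; linarith, ?_⟩
      rw [uIcc_of_le hab]; intro h; linarith [h.1]

lemma laplace {σ a b : ℝ} (hσ : σ < 1) (hσ0 : σ ≠ 0) (ha : 0 < a) (hb : 0 < b) :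
    IntegrableOn (fun t : ℝ => t ^ (-σ - 1) * (Real.exp (-(t * a)) - Real.exp (-(t * b)))) (Ioi 0) ∧
    ∫ t in Ioi (0:ℝ), t ^ (-σ - 1) * (Real.exp (-(t * a)) - Real.exp (-(t * b)))
      = Real.Gamma (-σ) * (a ^ σ - b ^ σ) ∧
    ∫ t in Ioi (0:ℝ), |t ^ (-σ - 1) * (Real.exp (-(t * a)) - Real.exp (-(t * b)))|
      = |Real.Gamma (-σ) * (a ^ σ - b ^ σ)| := by
  have abs1 : ∀ a b : ℝ, 0 < a → a ≤ b → 
    ∫ t in Ioi (0:ℝ), |t ^ (-σ - 1) * (Real.exp (-(t * a)) - Real.exp (-(t * b)))|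
      = |Real.Gamma (-σ) * (a ^ σ - b ^ σ)| := by
    intro a b ha hab
    have hn : ∀ t ∈ Ioi (0:ℝ), 0 ≤ t ^ (-σ - 1) * (Real.exp (-(t * a)) - Real.exp (-(t * b))) := by
      intro t ht
      have ht' : (0:ℝ) < t := ht
      have : Real.exp (-(t * b)) ≤ Real.exp (-(t * a)) := by
        apply Real.exp_le_exp.2; nlinarith
      apply mul_nonneg (by positivity); linarith
    rw [← (laplace_le hσ hσ0 ha hab).2, abs_of_nonneg (setIntegral_nonneg measurableSet_Ioi hn)]
    apply setIntegral_congr_fun measurableSet_Ioi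
    intro t ht
    exact abs_of_nonneg (hn t ht)
  rcases le_total a b with h | h
  · exact ⟨(laplace_le hσ hσ0 ha h).1, (laplace_le hσ hσ0 ha h).2, abs1 a b ha h⟩
  · have e : (fun t : ℝ => t ^ (-σ - 1) * (Real.exp (-(t * a)) - Real.exp (-(t * b))))
      = fun t : ℝ => -(t ^ (-σ - 1) * (Real.exp (-(t * b)) - Real.exp (-(t * a)))) := by
      funext t; ring
    refine ⟨?_, ?_, ?_⟩
    · rw [e]; exact (laplace_le hσ hσ0 hb h).1.neg
    · rw [e, integral_neg, (laplace_le hσ hσ0 hb h).2]; ring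
    · have := abs1 b a hb h
      rw [← abs_neg, ← mul_neg, neg_sub] at this
      rw [← this]
      congr 1; funext t
      rw [← abs_neg]; congr 1; ring

lemma betaInt {p q : ℝ} (hp : 0 < p) (hq : 0 < q) :
    IntegrableOn (fun v : ℝ => v ^ (p - 1) * (1 + v) ^ (-(p + q))) (Ioi 0) ∧
    ∫ v in Ioi (0:ℝ), v ^ (p - 1) * (1 + v) ^ (-(p + q))
      = Real.Gamma p * Real.Gamma q / Real.Gamma (p + q) := by
  have hG : 0 < Real.Gamma (p + q) := Real.Gamma_pos_of_pos (by linarith)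
  let f : ℝ → ℝ → ℝ := fun v t => v ^ (p - 1) * (t ^ (p + q - 1) * Real.exp (-((1 + v) * t)))
  have hf1 : ∀ v ∈ Ioi (0:ℝ), ∫ t in Ioi (0:ℝ), f v t
      = v ^ (p - 1) * (1 + v) ^ (-(p + q)) * Real.Gamma (p + q) := by
    intro v hv
    have hv' : (0:ℝ) < v := hv
    simp only [f]
    rw [integral_const_mul, Real.integral_rpow_mul_exp_neg_mul_Ioi (by linarith) (by linarith),
      one_div, Real.inv_rpow (by linarith), ← Real.rpow_neg (by linarith)]
    ring
  have hf2 : ∀ t ∈ Ioi (0:ℝ), ∫ v in Ioi (0:ℝ), f v t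
      = Real.Gamma p * (t ^ (q - 1) * Real.exp (-(1 * t))) := by
    intro t ht
    have ht' : (0:ℝ) < t := ht
    have : ∀ v, f v t = (t ^ (p + q - 1) * Real.exp (-(1 * t))) *
        (v ^ (p - 1) * Real.exp (-(t * v))) := by
      intro v
      simp only [f]
      rw [show -((1 + v) * t) = -(1 * t) + -(t * v) by ring, Real.exp_add]; ring
    simp only [this]
    rw [integral_const_mul, Real.integral_rpow_mul_exp_neg_mul_Ioi hp ht', one_div,
      Real.inv_rpow ht'.le, ← Real.rpow_neg ht'.le]
    have : t ^ (q - 1) = t ^ (p + q - 1) * t ^ (-p) := by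
      rw [← Real.rpow_add ht']; congr 1; ring
    rw [this]; ring
  have hprod : Integrable (Function.uncurry f)
      ((volume.restrict (Ioi (0:ℝ))).prod (volume.restrict (Ioi (0:ℝ)))) := by
    rw [integrable_prod_iff']
    · constructor
      · filter_upwards [ae_restrict_mem measurableSet_Ioi] with t ht
        have ht' : (0:ℝ) < t := ht
        have : (fun v => Function.uncurry f (v, t)) = fun v => (t ^ (p + q - 1) * Real.exp (-(1 * t))) *
            (v ^ (p - 1) * Real.exp (-(t * v))) := by
          funext v
          simp only [f, Function.uncurry]
          rw [show -((1 + v) * t) = -(1 * t) + -(t * v) by ring, Real.exp_add]; ring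
        rw [this]
        exact (gam_int hp ht').const_mul _
      · refine (((gam_int hq one_pos).const_mul (Real.Gamma p))).congr ?_
        filter_upwards [ae_restrict_mem measurableSet_Ioi] with t ht
        rw [← hf2 t ht]
        apply setIntegral_congr_fun measurableSet_Ioi
        intro v hv
        have ht' : (0:ℝ) < t := ht
        have hv' : (0:ℝ) < v := hv
        simp only [Real.norm_eq_abs, Function.uncurry, f]
        rw [abs_of_nonneg]; positivity
    · apply Measurable.aestronglyMeasurable
      simp only [f]
      fun_prop
  constructor
  · have := (hprod.integral_prod_left).div_const (Real.Gamma (p + q))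
    refine this.congr ?_
    filter_upwards [ae_restrict_mem measurableSet_Ioi] with v hv
    have := hf1 v hv
    simp only [Function.uncurry]
    rw [this]; field_simp
  · have h := integral_integral_swap hprod
    rw [setIntegral_congr_fun measurableSet_Ioi hf1, setIntegral_congr_fun measurableSet_Ioi hf2,
      integral_mul_const, integral_const_mul, Real.integral_rpow_mul_exp_neg_mul_Ioi hq one_pos] at h
    rw [eq_div_iff hG.ne', h]; simp

lemma vInt {s a : ℝ} (hs0 : 0 < s) (hs1 : s < 1) (ha : 0 < a + s)
    (hInteg : IntegrableOn (fun v : ℝ => v ^ (s - 1) * (1 - (v / (1 + v)) ^ a)) (Ioi 0)) :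
    ∫ v in Ioi (0:ℝ), v ^ (s - 1) * (1 - (v / (1 + v)) ^ a)
      = Real.Gamma (1 - s) * Real.Gamma (a + s) / (s * Real.Gamma a) := by
  have hB := betaInt ha (show 0 < 1 - s by linarith)
  have hu : ∀ v ∈ Ioi (0:ℝ), HasDerivAt (fun v : ℝ => 1 - (v / (1 + v)) ^ a)
      (-(a * v ^ (a - 1) * (1 + v) ^ (-(a + 1)))) v := by
    intro v hv
    have hv' : (0:ℝ) < v := hv
    have h1 : HasDerivAt (fun v : ℝ => v / (1 + v)) (1 / (1 + v) ^ 2) v := by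
      have := (hasDerivAt_id v).div ((hasDerivAt_id v).const_add 1) (by simp; linarith)
      exact this.congr_deriv (by simp)
    have h2 := (h1.rpow_const (p := a) (Or.inl (by positivity))).const_sub 1
    refine h2.congr_deriv ?_
    rw [Real.div_rpow hv'.le (by linarith), neg_inj]
    have : (1 + v) ^ (-(a + 1)) = ((1 + v) ^ (a - 1))⁻¹ * ((1 + v) ^ 2)⁻¹ := by
      rw [← Real.rpow_neg (by linarith), ← Real.rpow_natCast, ← Real.rpow_neg (by linarith),
        ← Real.rpow_add (by linarith)]
      congr 1; push_cast; ring
    rw [this]; field_simp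
  have hv : ∀ v ∈ Ioi (0:ℝ), HasDerivAt (fun v : ℝ => v ^ s / s) (v ^ (s - 1)) v := by
    intro v hv
    have hv' : (0:ℝ) < v := hv
    have := (Real.hasDerivAt_rpow_const (p := s) (Or.inl hv'.ne')).div_const s
    exact this.congr_deriv (by field_simp)
  have e2 : ∀ v ∈ Ioi (0:ℝ), -(a / s) * (v ^ (a + s - 1) * (1 + v) ^ (-(a + s + (1 - s)))) =
      -(a * v ^ (a - 1) * (1 + v) ^ (-(a + 1))) * (v ^ s / s) := by
    intro v hv
    have hv' : (0:ℝ) < v := hv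
    have : v ^ (a + s - 1) = v ^ (a - 1) * v ^ s := by
      rw [← Real.rpow_add hv']; congr 1; ring
    rw [this, show -(a + s + (1 - s)) = -(a + 1) by ring]; ring
  have h0 : Tendsto ((fun v : ℝ => 1 - (v / (1 + v)) ^ a) * (fun v : ℝ => v ^ s / s))
      (𝓝[>] 0) (𝓝 0) := by
    have h1 : Tendsto (fun v : ℝ => (v ^ s - v ^ (a + s) * (1 + v) ^ (-a)) / s) (𝓝[>] 0)
        (𝓝 (((0:ℝ) ^ s - 0 ^ (a + s) * (1 + 0) ^ (-a)) / s)) := by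
      apply Tendsto.mono_left _ nhdsWithin_le_nhds
      have c1 : ContinuousAt (fun v : ℝ => v ^ s) 0 := 
        Real.continuousAt_rpow_const _ _ (Or.inr hs0.le)
      have c2 : ContinuousAt (fun v : ℝ => v ^ (a + s)) 0 := 
        Real.continuousAt_rpow_const _ _ (Or.inr ha.le)
      have c3 : ContinuousAt (fun v : ℝ => (1 + v) ^ (-a)) 0 := 
        ContinuousAt.rpow_const (by fun_prop) (Or.inl (by norm_num))
      exact ((c1.sub (c2.mul c3)).div_const s)
    rw [Real.zero_rpow hs0.ne', Real.zero_rpow ha.ne'] at h1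
    simp only [zero_mul, sub_zero, zero_div] at h1
    refine h1.congr' ?_
    filter_upwards [self_mem_nhdsWithin] with v hv
    have hv' : (0:ℝ) < v := hv
    simp only [Pi.mul_apply]
    rw [Real.div_rpow hv'.le (by linarith), Real.rpow_neg (by linarith), Real.rpow_add hv']
    ring
  have hinf : Tendsto ((fun v : ℝ => 1 - (v / (1 + v)) ^ a) * (fun v : ℝ => v ^ s / s))
      atTop (𝓝 0) := by
    have hq : Tendsto (fun v : ℝ => v / (1 + v)) atTop (𝓝[≠] 1) := by
      rw [tendsto_nhdsWithin_iff]
      constructor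
      · have : Tendsto (fun v : ℝ => 1 - (1 + v)⁻¹) atTop (𝓝 (1 - 0)) := by
          apply Tendsto.const_sub
          exact (tendsto_inv_atTop_zero).comp (tendsto_atTop_add_const_left _ _ tendsto_id)
        rw [sub_zero] at this
        refine this.congr' ?_
        filter_upwards [eventually_gt_atTop 0] with v hv
        field_simp; ring
      · filter_upwards [eventually_gt_atTop 0] with v hv
        simp only [mem_compl_iff, mem_singleton_iff]
        rw [div_eq_one_iff_eq (by linarith)]; intro h; linarith
    have hd := (Real.hasDerivAt_rpow_const (x := 1) (p := a) (Or.inl one_ne_zero)).tendsto_slope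
    have h1 := hd.comp hq
    have h2 : Tendsto (fun v : ℝ => v ^ (s - 1) * (v / (1 + v)) / s) atTop (𝓝 (0 * 1 / s)) := by
      apply Tendsto.div_const
      apply Tendsto.mul
      · have := tendsto_rpow_neg_atTop (y := 1 - s) (by linarith)
        simpa using this
      · exact hq.mono_right nhdsWithin_le_nhds
    have h3 := h1.mul h2
    simp only [zero_mul, zero_div, mul_zero] at h3
    refine h3.congr' ?_
    filter_upwards [eventually_gt_atTop 0] with v hv
    simp only [Function.comp, Pi.mul_apply, slope_def_field, Real.one_rpow]
    have e1 : v / (1 + v) - 1 = -(1 / (1 + v)) := by field_simp; ring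
    have e3 : v ^ s = v ^ (s - 1) * v := by
      rw [← Real.rpow_add_one hv.ne']; congr 1; ring
    rw [e1, e3]
    field_simp
    ring
  have := integral_Ioi_mul_deriv_eq_deriv_mul (a' := 0) (b' := 0) hu hv ?_ ?_ h0 hinf
  · have e3 : ∫ v in Ioi (0:ℝ), v ^ (s - 1) * (1 - (v / (1 + v)) ^ a) 
       = ∫ v in Ioi (0:ℝ), (1 - (v / (1 + v)) ^ a) * v ^ (s - 1) := by
      congr 1; funext v; ring
    rw [e3, this, ← setIntegral_congr_fun measurableSet_Ioi e2, integral_const_mul, hB.2]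
    rw [show a + s + (1 - s) = a + 1 by ring]
    by_cases h : a = 0
    · subst h; simp [Real.Gamma_zero]
    · rw [Real.Gamma_add_one h]
      field_simp
      ring
  · refine hInteg.congr_fun ?_ measurableSet_Ioi
    intro v hv
    simp only [Pi.mul_apply]; ring
  · have hB1 : IntegrableOn (fun v : ℝ => -(a / s) * (v ^ (a + s - 1) * (1 + v) ^ (-(a + s + (1 - s)))))
        (Ioi 0) := hB.1.const_mul (-(a / s))
    refine hB1.congr_fun ?_ measurableSet_Ioi
    intro v hv
    exact e2 v hv

lemma nontriv_EN {N : ℕ} (hN : 2 ≤ N) : Nontrivial (EN N) := by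
  have : Nonempty (Fin N) := ⟨⟨0, by omega⟩⟩
  infer_instance

lemma normpow_small {N : ℕ} (hN : 2 ≤ N) {p : ℝ} (hp : -(N:ℝ) < p) {R : ℝ} (hR : 0 < R) :
    IntegrableOn (fun y : EN N => ‖y‖ ^ p) (ball 0 R) := by
  have := nontriv_EN hN
  have h := integrableOn_fun_norm_addHaar (E := EN N) volume (f := fun r : ℝ => r ^ p) (r := R)
  rw [h]
  have h2 : IntegrableOn (fun r : ℝ => r ^ (N - 1 + p)) (Ioo 0 R) := by
    rw [intervalIntegral.integrableOn_Ioo_rpow_iff hR]; linarith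
  refine h2.congr_fun ?_ measurableSet_Ioo
  intro r hr
  have hr' : (0:ℝ) < r := hr.1
  simp only [finrank_euclideanSpace, Fintype.card_fin, smul_eq_mul]
  rw [Real.rpow_add hr', ← Real.rpow_natCast]
  congr 2
  rw [Nat.cast_sub (by omega)]; simp

lemma normpow_large {N : ℕ} (hN : 2 ≤ N) {p : ℝ} (hp : p < -(N:ℝ)) {δ : ℝ} (hδ : 0 < δ) :
    IntegrableOn (fun y : EN N => ‖y‖ ^ p) {y | δ ≤ ‖y‖} := by
  have := nontriv_EN hN
  have h := integrable_fun_norm_addHaar (E := EN N) volume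
    (f := (Ici δ).indicator fun r : ℝ => r ^ p)
  have hm : MeasurableSet {y : EN N | δ ≤ ‖y‖} := measurableSet_le measurable_const measurable_norm
  rw [← integrable_indicator_iff hm]
  have e : ({y : EN N | δ ≤ ‖y‖}.indicator fun y : EN N => ‖y‖ ^ p) =
    fun y => (Ici δ).indicator (fun r : ℝ => r ^ p) ‖y‖ := by
    funext y; simp [indicator]
  rw [e, h]
  have h2 : IntegrableOn (fun r : ℝ => r ^ (N - 1 + p)) (Ici δ) := by
    rw [integrableOn_Ici_iff_integrableOn_Ioi]
    exact integrableOn_Ioi_rpow_of_lt (by linarith) hδ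
  have h3 := (integrable_indicator_iff measurableSet_Ici).2 h2
  refine (h3.integrableOn (s := Ioi 0)).congr_fun ?_ measurableSet_Ioi
  intro r hr
  have hr' : (0:ℝ) < r := hr
  simp only [finrank_euclideanSpace, Fintype.card_fin, smul_eq_mul, indicator]
  split_ifs
  · rw [Real.rpow_add hr', ← Real.rpow_natCast]
    congr 2
    rw [Nat.cast_sub (by omega)]; simp
  · simp

/-- integrability away from the singular point -/
lemma far_int {N : ℕ} (hN : 2 ≤ N) {s τ : ℝ} (hs : 0 < s) (hτ : -(N:ℝ) < τ) (hτ2 : τ < 2 * s)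
    (x : EN N) {δ : ℝ} (hδ : 0 < δ) :
    IntegrableOn (fun y : EN N => (‖x‖ ^ τ - ‖x + y‖ ^ τ) * ‖y‖ ^ (-((N:ℝ) + 2 * s)))
      {y | δ ≤ ‖y‖} := by
  have hm : MeasurableSet {y : EN N | δ ≤ ‖y‖} := measurableSet_le measurable_const measurable_norm
  set τ' := max τ 0 with hτ'
  have hτ'0 : 0 ≤ τ' := le_max_right _ _
  have hτ'2 : τ' < 2 * s := max_lt hτ2 (by linarith)
  have i1 : IntegrableOn (fun y : EN N => ‖x‖ ^ τ * ‖y‖ ^ (-((N:ℝ) + 2 * s))) {y | δ ≤ ‖y‖} :=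
    (normpow_large hN (by linarith) hδ).const_mul _
  have i2 : IntegrableOn (fun y : EN N => ((‖x‖ / δ + 1) ^ τ') * ‖y‖ ^ (τ' + -((N:ℝ) + 2 * s)))
      {y | δ ≤ ‖y‖} :=
    (normpow_large hN (by linarith) hδ).const_mul _
  have i3 : Integrable (fun y : EN N => (ball (0 : EN N) 1).indicator (fun z => ‖z‖ ^ τ) (x + y)
      * δ ^ (-((N:ℝ) + 2 * s))) := by
    apply Integrable.mul_const
    exact ((integrable_indicator_iff measurableSet_ball).2
      (normpow_small hN hτ one_pos)).comp_add_left x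
  have i4 : IntegrableOn (fun y : EN N => ‖x + y‖ ^ τ * ‖y‖ ^ (-((N:ℝ) + 2 * s)))
      {y | δ ≤ ‖y‖} := by
    refine Integrable.mono' ((i3.integrableOn (s := {y | δ ≤ ‖y‖})).add i2) ?_ ?_
    · apply Measurable.aestronglyMeasurable; fun_prop
    · filter_upwards [ae_restrict_mem hm] with y hy
      have hy : δ ≤ ‖y‖ := hy
      have hy0 : 0 < ‖y‖ := hδ.trans_le hy
      rw [Real.norm_eq_abs, abs_of_nonneg (by positivity)]
      simp only [Pi.add_apply]
      have hneg : ‖y‖ ^ (-((N:ℝ) + 2 * s)) ≤ δ ^ (-((N:ℝ) + 2 * s)) := by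
        apply Real.rpow_le_rpow_of_nonpos hδ hy
        have : (0:ℝ) ≤ N := Nat.cast_nonneg N
        linarith
      by_cases hz : ‖x + y‖ < 1
      · have hz' : x + y ∈ ball (0 : EN N) 1 := by simpa using hz
        rw [indicator_of_mem hz']
        have : ‖x + y‖ ^ τ * ‖y‖ ^ (-((N:ℝ) + 2 * s)) ≤ ‖x + y‖ ^ τ * δ ^ (-((N:ℝ) + 2 * s)) := by
          gcongr
        have h2 : 0 ≤ (‖x‖ / δ + 1) ^ τ' * ‖y‖ ^ (τ' + -((N:ℝ) + 2 * s)) := by positivity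
        linarith
      · have hz' : x + y ∉ ball (0 : EN N) 1 := by simpa using hz
        rw [indicator_of_notMem hz', zero_mul, zero_add, Real.rpow_add hy0, ← mul_assoc]
        gcongr
        push Not at hz
        calc ‖x + y‖ ^ τ ≤ ‖x + y‖ ^ τ' := 
              Real.rpow_le_rpow_of_exponent_le hz (le_max_left _ _)
          _ ≤ ((‖x‖ / δ + 1) * ‖y‖) ^ τ' := by
              gcongr
              calc ‖x + y‖ ≤ ‖x‖ + ‖y‖ := norm_add_le _ _
                _ ≤ ‖x‖ / δ * ‖y‖ + ‖y‖ := by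
                  gcongr
                  rw [div_mul_eq_mul_div, le_div_iff₀ hδ]
                  gcongr
                _ = _ := by ring
          _ = _ := Real.mul_rpow (by positivity) hy0.le
  refine (i1.sub i4).congr ?_
  filter_upwards with y
  simp only [Pi.sub_apply]; ring

/-- Gaussian second difference bound. -/
lemma gauss_bound {N : ℕ} (x y : EN N) {t : ℝ} (ht : 0 < t) (hy : 4 * ‖y‖ ≤ ‖x‖) :
    |2 * Real.exp (-(t * ‖x‖ ^ 2)) - Real.exp (-(t * ‖x + y‖ ^ 2)) - Real.exp (-(t * ‖x - y‖ ^ 2))|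
      ≤ ‖y‖ ^ 2 * (2 * t + 4 * t ^ 2 * ‖x‖ ^ 2) * Real.exp (-(‖x‖ ^ 2 / 2 * t)) := by
  set p := inner ℝ x y with hp
  have hpb : |p| ≤ ‖x‖ * ‖y‖ := abs_real_inner_le_norm x y
  set b := 2 * t * p with hb
  have hbb : |b| ≤ t * ‖x‖ ^ 2 / 2 := by
    rw [hb, abs_mul, abs_of_pos (by positivity : 0 < 2 * t)]
    have : ‖x‖ * ‖y‖ ≤ ‖x‖ ^ 2 / 4 := by nlinarith [norm_nonneg x, norm_nonneg y]
    nlinarith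
  have hb2 : b ^ 2 ≤ 4 * t ^ 2 * ‖x‖ ^ 2 * ‖y‖ ^ 2 := by
    have : p ^ 2 ≤ (‖x‖ * ‖y‖) ^ 2 := by
      rw [← sq_abs p]; gcongr
    rw [hb]; nlinarith [sq_nonneg t]
  have e1 : Real.exp (-(t * ‖x + y‖ ^ 2)) + Real.exp (-(t * ‖x - y‖ ^ 2)) =
      Real.exp (-(t * ‖x‖ ^ 2)) * Real.exp (-(t * ‖y‖ ^ 2)) * (2 * Real.cosh b) := by
    rw [norm_add_sq_real, norm_sub_sq_real, Real.cosh_eq, mul_div_cancel₀ _ two_ne_zero,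
      add_comm (Real.exp b), mul_add (Real.exp _ * Real.exp _),
      ← Real.exp_add, ← Real.exp_add, ← Real.exp_add]
    congr 2 <;> simp only [hb, hp] <;> ring
  have hc1 : 1 ≤ Real.cosh b := Real.one_le_cosh b
  have hc2 : Real.cosh b ≤ Real.exp (t * ‖x‖ ^ 2 / 2) := by
    rw [← Real.cosh_abs, Real.cosh_eq]
    have h1 := Real.exp_le_exp.2 hbb
    have h2 : Real.exp (-|b|) ≤ Real.exp (t * ‖x‖ ^ 2 / 2) := 
      Real.exp_le_exp.2 (by linarith [abs_nonneg b])
    linarith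
  have hc3 : Real.cosh b - 1 ≤ b ^ 2 / 2 * Real.cosh b := by
    have h1 := Real.cosh_le_exp_half_sq b
    have h2 := Real.add_one_le_exp (-(b ^ 2 / 2))
    have h3 : 1 - b ^ 2 / 2 ≤ Real.exp (-(b^2/2)) := by linarith
    have h4 : Real.exp (-(b^2/2)) * Real.cosh b ≤ 1 := by
      rw [Real.exp_neg, inv_mul_le_iff₀ (Real.exp_pos _), mul_one]; exact h1
    nlinarith
  have he1 : Real.exp (-(t * ‖y‖ ^ 2)) ≤ 1 := by
    apply Real.exp_le_one_iff.2; nlinarith [sq_nonneg ‖y‖]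
  have he2 : 1 - t * ‖y‖ ^ 2 ≤ Real.exp (-(t * ‖y‖ ^ 2)) := by
    linarith [Real.add_one_le_exp (-(t * ‖y‖ ^ 2))]
  have he0 := Real.exp_pos (-(t * ‖y‖ ^ 2))
  have hX := Real.exp_pos (-(t * ‖x‖ ^ 2))
  have hEE : Real.exp (-(t * ‖x‖ ^ 2)) * Real.exp (t * ‖x‖ ^ 2 / 2) = 
    Real.exp (-(‖x‖ ^ 2 / 2 * t)) := by rw [← Real.exp_add]; congr 1; ring
  have hle : Real.exp (-(t * ‖x‖ ^ 2)) ≤ Real.exp (-(‖x‖ ^ 2 / 2 * t)) := by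
    apply Real.exp_le_exp.2; nlinarith [sq_nonneg ‖x‖]
  set e := Real.exp (-(t * ‖y‖ ^ 2))
  set X := Real.exp (-(t * ‖x‖ ^ 2))
  set G := Real.exp (-(‖x‖ ^ 2 / 2 * t))
  have e2 : 2 * X - Real.exp (-(t * ‖x + y‖ ^ 2)) - Real.exp (-(t * ‖x - y‖ ^ 2)) =
     2 * X * (1 - e * Real.cosh b) := by rw [sub_sub, e1]; ring
  rw [e2, abs_mul, abs_of_pos (by positivity)]
  have h1 : |1 - e * Real.cosh b| ≤ t * ‖y‖ ^ 2 + b ^ 2 / 2 * Real.cosh b := by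
    have hh : 0 ≤ b ^ 2 / 2 * Real.cosh b := by positivity
    rw [abs_le]; constructor
    · have : e * Real.cosh b ≤ 1 * Real.cosh b := by gcongr
      nlinarith [sq_nonneg ‖y‖]
    · nlinarith
  have h2 : X * Real.cosh b ≤ G := by rw [← hEE]; gcongr
  calc 2 * X * |1 - e * Real.cosh b| ≤ 2 * X * (t * ‖y‖ ^ 2 + b ^ 2 / 2 * Real.cosh b) := by gcongr
    _ = 2 * t * ‖y‖ ^ 2 * X + b ^ 2 * (X * Real.cosh b) := by ring
    _ ≤ 2 * t * ‖y‖ ^ 2 * G + (4 * t ^ 2 * ‖x‖ ^ 2 * ‖y‖ ^ 2) * G := by gcongr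
    _ = _ := by ring

lemma gauss_int {N : ℕ} (x : EN N) {c d : ℝ} (hc : 0 < c) (hd : 0 ≤ d) :
    Integrable (fun y : EN N => Real.exp (-(d * ‖x + y‖ ^ 2)) * Real.exp (-(c * ‖y‖ ^ 2))) ∧
    ∫ y : EN N, Real.exp (-(d * ‖x + y‖ ^ 2)) * Real.exp (-(c * ‖y‖ ^ 2))
      = (Real.pi / (c + d)) ^ ((N:ℝ) / 2) * Real.exp (-(c * d / (c + d) * ‖x‖ ^ 2)) := by
  have hcd : 0 < c + d := by linarith
  have e : (fun y : EN N => Real.exp (-(d * ‖x + y‖ ^ 2)) * Real.exp (-(c * ‖y‖ ^ 2))) =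
      fun y => (fun w : EN N => Real.exp (-(c * d / (c + d) * ‖x‖ ^ 2)) *
        Real.exp (-(c + d) * ‖w‖ ^ 2)) (y + (d / (c + d)) • x) := by
    funext y
    simp only
    rw [← Real.exp_add, ← Real.exp_add]
    congr 1
    rw [norm_add_sq_real, norm_add_sq_real, norm_smul, inner_smul_right, mul_pow, Real.norm_eq_abs,
      sq_abs, real_inner_comm]
    field_simp
    ring
  have hval : ∫ v : EN N, Real.exp (-(c + d) * ‖v‖ ^ 2) = (Real.pi / (c + d)) ^ ((N:ℝ) / 2) := by
    have := GaussianFourier.integral_rexp_neg_mul_sq_norm (V := EN N) hcd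
    simpa using this
  have hi : Integrable (fun v : EN N => Real.exp (-(c + d) * ‖v‖ ^ 2)) := by
    by_contra h
    rw [integral_undef h] at hval
    have : 0 < (Real.pi / (c + d)) ^ ((N:ℝ) / 2) := by
      have := Real.pi_pos; positivity
    linarith
  constructor
  · rw [e]
    exact Integrable.comp_add_right (hi.const_mul _) _
  · rw [e, integral_add_right_eq_self (fun w : EN N => Real.exp (-(c * d / (c + d) * ‖x‖ ^ 2)) *
        Real.exp (-(c + d) * ‖w‖ ^ 2)), integral_const_mul, hval, mul_comm]

lemma F_integrable {N : ℕ} (hN : 2 ≤ N) {s σ : ℝ} (hs : 0 < s) (hs1 : s < 1) (hσ0 : σ ≠ 0)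
    (hσN : -(N:ℝ) < 2 * σ) (hσs : σ < s) {x : EN N} (hx : x ≠ 0) :
    (Integrable (fun p : EN N × ℝ => p.2 ^ (-σ - 1) * (2 * Real.exp (-(p.2 * ‖x‖ ^ 2))
      - Real.exp (-(p.2 * ‖x + p.1‖ ^ 2)) - Real.exp (-(p.2 * ‖x - p.1‖ ^ 2)))
        * ‖p.1‖ ^ (-((N:ℝ) + 2 * s))) (volume.prod (volume.restrict (Ioi 0)))) ∧
    (∀ᵐ y : EN N, ∫ t in Ioi (0:ℝ), t ^ (-σ - 1) * (2 * Real.exp (-(t * ‖x‖ ^ 2))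
      - Real.exp (-(t * ‖x + y‖ ^ 2)) - Real.exp (-(t * ‖x - y‖ ^ 2)))
        * ‖y‖ ^ (-((N:ℝ) + 2 * s)) = 
      Real.Gamma (-σ) * ((2 * ‖x‖ ^ (2 * σ) - ‖x + y‖ ^ (2 * σ) - ‖x - y‖ ^ (2 * σ)) *
        ‖y‖ ^ (-((N:ℝ) + 2 * s)))) := by
  have := nontriv_EN hN
  have hρ : 0 < ‖x‖ := norm_pos_iff.2 hx
  have hsq : ∀ z : EN N, (‖z‖ ^ 2) ^ σ = ‖z‖ ^ (2 * σ) := by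
    intro z
    rw [← Real.rpow_natCast, ← Real.rpow_mul (norm_nonneg _)]; norm_num
  have hae : ∀ᵐ y : EN N, y ≠ 0 ∧ x + y ≠ 0 ∧ x - y ≠ 0 := by
    have h1 : ∀ᵐ y : EN N, y ≠ 0 := by simp [ae_iff, measure_singleton]
    have h2 : ∀ᵐ y : EN N, y ≠ -x := by simp [ae_iff, measure_singleton]
    have h3 : ∀ᵐ y : EN N, y ≠ x := by simp [ae_iff, measure_singleton]
    filter_upwards [h1, h2, h3] with y h1 h2 h3
    refine ⟨h1, ?_, ?_⟩
    · intro h; exact h2 (eq_neg_of_add_eq_zero_right h)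
    · intro h; exact h3 (sub_eq_zero.1 h).symm
  have hσ1 : σ < 1 := hσs.trans hs1
  have split : ∀ (y : EN N) (t : ℝ), t ^ (-σ - 1) * (2 * Real.exp (-(t * ‖x‖ ^ 2))
      - Real.exp (-(t * ‖x + y‖ ^ 2)) - Real.exp (-(t * ‖x - y‖ ^ 2)))
        * ‖y‖ ^ (-((N:ℝ) + 2 * s)) = 
      (t ^ (-σ - 1) * (Real.exp (-(t * ‖x‖ ^ 2)) - Real.exp (-(t * ‖x + y‖ ^ 2))) +
      t ^ (-σ - 1) * (Real.exp (-(t * ‖x‖ ^ 2)) - Real.exp (-(t * ‖x - y‖ ^ 2)))) 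
        * ‖y‖ ^ (-((N:ℝ) + 2 * s)) := by intros; ring
  have hlap : ∀ z : EN N, z ≠ 0 → _ := fun z hz => laplace hσ1 hσ0 (a := ‖x‖ ^ 2) (b := ‖z‖ ^ 2)
    (by positivity) (by have := norm_pos_iff.2 hz; positivity)
  have hslice : ∀ y : EN N, y ≠ 0 → x + y ≠ 0 → x - y ≠ 0 → 
     IntegrableOn (fun t : ℝ => t ^ (-σ - 1) * (2 * Real.exp (-(t * ‖x‖ ^ 2))
      - Real.exp (-(t * ‖x + y‖ ^ 2)) - Real.exp (-(t * ‖x - y‖ ^ 2)))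
        * ‖y‖ ^ (-((N:ℝ) + 2 * s))) (Ioi 0) := by
    intro y h0 h1 h2
    simp only [split]
    exact ((hlap _ h1).1.add (hlap _ h2).1).mul_const _
  constructor
  · have hmeas : AEStronglyMeasurable (fun p : EN N × ℝ => p.2 ^ (-σ - 1) * (2 * Real.exp (-(p.2 * ‖x‖ ^ 2))
      - Real.exp (-(p.2 * ‖x + p.1‖ ^ 2)) - Real.exp (-(p.2 * ‖x - p.1‖ ^ 2)))
        * ‖p.1‖ ^ (-((N:ℝ) + 2 * s))) (volume.prod (volume.restrict (Ioi 0))) := by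
      apply Measurable.aestronglyMeasurable; fun_prop
    rw [integrable_prod_iff hmeas]
    constructor
    · filter_upwards [hae] with y hy
      exact hslice y hy.1 hy.2.1 hy.2.2
    · have hM := hmeas.norm.integral_prod_right'
      set δ := ‖x‖ / 4 with hδ
      have hδ0 : 0 < δ := by positivity
      rw [← integrableOn_univ]
      have hU : (univ : Set (EN N)) = ball 0 δ ∪ {y | δ ≤ ‖y‖} := by
        ext y; simp [lt_or_ge]
      rw [hU]
      apply IntegrableOn.union
      · -- near
        have hc : 0 < ‖x‖ ^ 2 / 2 := by positivity
        have hC : IntegrableOn (fun t : ℝ => t ^ (-σ - 1) * ((2 * t + 4 * t ^ 2 * ‖x‖ ^ 2) *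
            Real.exp (-(‖x‖ ^ 2 / 2 * t)))) (Ioi 0) := by
          have g1 := (gam_int (a := 1 - σ) (by linarith) hc).const_mul 2
          have g2 := (gam_int (a := 2 - σ) (by linarith) hc).const_mul (4 * ‖x‖ ^ 2)
          refine IntegrableOn.congr_fun (g1.add g2) ?_ measurableSet_Ioi
          intro t ht
          have ht' : (0:ℝ) < t := ht
          simp only [Pi.add_apply]
          have e1 : t ^ (1 - σ - 1) = t ^ (-σ - 1) * t := by
            rw [← Real.rpow_add_one ht'.ne']; congr 1; ring
          have e2 : t ^ (2 - σ - 1) = t ^ (-σ - 1) * t ^ 2 := by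
            rw [← Real.rpow_natCast t 2, ← Real.rpow_add ht']; congr 1; push_cast; ring
          rw [e1, e2]; ring
        set C := ∫ t in Ioi (0:ℝ), t ^ (-σ - 1) * ((2 * t + 4 * t ^ 2 * ‖x‖ ^ 2) *
            Real.exp (-(‖x‖ ^ 2 / 2 * t)))
        have hb : IntegrableOn (fun y : EN N => C * ‖y‖ ^ (2 + -((N:ℝ) + 2 * s))) (ball 0 δ) :=
          (normpow_small hN (by linarith) hδ0).const_mul C
        refine Integrable.mono' hb hM.restrict ?_
        filter_upwards [ae_restrict_mem measurableSet_ball, ae_restrict_of_ae hae] with y hy hy2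
        have hy' : ‖y‖ < δ := by simpa using hy
        have hy0 : 0 < ‖y‖ := norm_pos_iff.2 hy2.1
        rw [Real.norm_eq_abs, abs_of_nonneg (integral_nonneg fun t => norm_nonneg _)]
        have hK : ‖y‖ ^ (2 + -((N:ℝ) + 2 * s)) = ‖y‖ ^ 2 * ‖y‖ ^ (-((N:ℝ) + 2 * s)) := by
          rw [Real.rpow_add hy0]; norm_num
        rw [hK, ← integral_mul_const]
        apply setIntegral_mono_on (hslice y hy2.1 hy2.2.1 hy2.2.2).norm (hC.mul_const _)
          measurableSet_Ioi
        intro t ht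
        have ht' : (0:ℝ) < t := ht
        have hg := gauss_bound x y ht' (by linarith)
        rw [Real.norm_eq_abs, abs_mul, abs_mul, abs_of_nonneg (by positivity : 0 ≤ t ^ (-σ - 1)),
          abs_of_nonneg (by positivity : 0 ≤ ‖y‖ ^ (-((N:ℝ) + 2 * s)))]
        calc _ ≤ t ^ (-σ - 1) * (‖y‖ ^ 2 * (2 * t + 4 * t ^ 2 * ‖x‖ ^ 2) * 
                  Real.exp (-(‖x‖ ^ 2 / 2 * t))) * ‖y‖ ^ (-((N:ℝ) + 2 * s)) := by gcongr
          _ = _ := by ring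
      · -- far
        have hm : MeasurableSet {y : EN N | δ ≤ ‖y‖} :=
          measurableSet_le measurable_const measurable_norm
        have f1 := (far_int hN hs hσN (by linarith) x hδ0).norm.const_mul |Real.Gamma (-σ)|
        have f2 := (far_int hN hs hσN (by linarith) (-x) hδ0).norm.const_mul |Real.Gamma (-σ)|
        refine Integrable.mono' (f1.add f2) hM.restrict ?_
        filter_upwards [ae_restrict_mem hm, ae_restrict_of_ae hae] with y hy hy2
        rw [Real.norm_eq_abs, abs_of_nonneg (integral_nonneg fun t => norm_nonneg _)]
        have l1 := hlap _ hy2.2.1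
        have l2 := hlap _ hy2.2.2
        have hKn : 0 ≤ ‖y‖ ^ (-((N:ℝ) + 2 * s)) := by positivity
        calc _ ≤ ∫ t in Ioi (0:ℝ), 
                (|t ^ (-σ - 1) * (Real.exp (-(t * ‖x‖ ^ 2)) - Real.exp (-(t * ‖x + y‖ ^ 2)))| +
                |t ^ (-σ - 1) * (Real.exp (-(t * ‖x‖ ^ 2)) - Real.exp (-(t * ‖x - y‖ ^ 2)))|) 
                * ‖y‖ ^ (-((N:ℝ) + 2 * s)) := by
              apply integral_mono_of_nonneg
              · exact ae_of_all _ fun t => norm_nonneg _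
              · exact (l1.1.norm.add l2.1.norm).mul_const _
              · refine ae_of_all _ fun t => ?_
                simp only [split, Real.norm_eq_abs]
                rw [abs_mul, abs_of_nonneg hKn]
                gcongr
                exact abs_add_le _ _
          _ = _ := by
              have ia : ∀ z : EN N, z ≠ 0 → IntegrableOn (fun t : ℝ => 
                |t ^ (-σ - 1) * (Real.exp (-(t * ‖x‖ ^ 2)) - Real.exp (-(t * ‖z‖ ^ 2)))|) (Ioi 0) :=
                fun z hz => (hlap z hz).1.norm
              rw [integral_mul_const, integral_add (ia _ hy2.2.1) (ia _ hy2.2.2), l1.2.2, l2.2.2,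
                hsq, hsq, hsq]
              simp only [Pi.add_apply, norm_mul, Real.norm_eq_abs, norm_neg, abs_mul]
              rw [show -x + y = -(x - y) by abel, norm_neg, abs_of_nonneg hKn]
              ring
  · filter_upwards [hae] with y hy
    simp only [split]
    have l1 := hlap _ hy.2.1
    have l2 := hlap _ hy.2.2
    rw [integral_mul_const, integral_add l1.1 l2.1, l1.2.1, l2.2.1, hsq, hsq, hsq]
    ring

lemma inner_y {N : ℕ} {s σ : ℝ} (x : EN N) {t v : ℝ} (ht : 0 < t) (hv : 0 < v) :
    ∫ y : EN N, t ^ (-σ - 1) * (2 * Real.exp (-(t * ‖x‖ ^ 2))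
      - Real.exp (-(t * ‖x + y‖ ^ 2)) - Real.exp (-(t * ‖x - y‖ ^ 2)))
        * (t ^ ((N:ℝ) / 2 + s) * (v ^ ((N:ℝ) / 2 + s - 1) * Real.exp (-((t * ‖y‖ ^ 2) * v))))
    = 2 * Real.pi ^ ((N:ℝ) / 2) * v ^ ((N:ℝ) / 2 + s - 1) *
      (v ^ (-((N:ℝ) / 2)) * (t ^ (s - σ - 1) * Real.exp (-(‖x‖ ^ 2 * t))) -
       (1 + v) ^ (-((N:ℝ) / 2)) * (t ^ (s - σ - 1) * Real.exp (-(‖x‖ ^ 2 * (v / (1 + v)) * t)))) := by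
  have hpi := Real.pi_pos
  have htv : 0 < t * v := by positivity
  obtain ⟨i0, e0⟩ := gauss_int (0 : EN N) htv le_rfl
  obtain ⟨i1, e1⟩ := gauss_int x htv ht.le
  obtain ⟨i2, e2⟩ := gauss_int (-x) htv ht.le
  have hn : ∀ y : EN N, ‖-x + y‖ = ‖x - y‖ := fun y => by
    rw [show -x + y = -(x - y) by abel, norm_neg]
  simp only [hn, norm_neg] at i2 e2
  simp only [zero_mul, neg_zero, Real.exp_zero, one_mul, add_zero, mul_zero, zero_div, norm_zero,
    mul_one] at i0 e0
  have split : ∀ y : EN N, t ^ (-σ - 1) * (2 * Real.exp (-(t * ‖x‖ ^ 2))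
      - Real.exp (-(t * ‖x + y‖ ^ 2)) - Real.exp (-(t * ‖x - y‖ ^ 2)))
        * (t ^ ((N:ℝ) / 2 + s) * (v ^ ((N:ℝ) / 2 + s - 1) * Real.exp (-((t * ‖y‖ ^ 2) * v)))) =
      (t ^ (-σ - 1) * t ^ ((N:ℝ) / 2 + s) * v ^ ((N:ℝ) / 2 + s - 1)) *
       ((2 * Real.exp (-(t * ‖x‖ ^ 2))) * Real.exp (-(t * v * ‖y‖ ^ 2)) -
        Real.exp (-(t * ‖x + y‖ ^ 2)) * Real.exp (-(t * v * ‖y‖ ^ 2)) -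
        Real.exp (-(t * ‖x - y‖ ^ 2)) * Real.exp (-(t * v * ‖y‖ ^ 2))) := by
    intro y
    rw [show -((t * ‖y‖ ^ 2) * v) = -(t * v * ‖y‖ ^ 2) by ring]; ring
  simp only [split]
  have i01 : Integrable (fun y : EN N => (2 * Real.exp (-(t * ‖x‖ ^ 2))) *
      Real.exp (-(t * v * ‖y‖ ^ 2)) -
      Real.exp (-(t * ‖x + y‖ ^ 2)) * Real.exp (-(t * v * ‖y‖ ^ 2))) := (i0.const_mul _).sub i1
  rw [integral_const_mul, integral_sub i01 i2,
    integral_sub (i0.const_mul _) i1, integral_const_mul, e0, e1, e2]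
  have h1 : (Real.pi / (t * v)) ^ ((N:ℝ) / 2) =
      Real.pi ^ ((N:ℝ) / 2) * t ^ (-((N:ℝ) / 2)) * v ^ (-((N:ℝ) / 2)) := by
    rw [Real.div_rpow hpi.le htv.le, Real.mul_rpow ht.le hv.le, Real.rpow_neg ht.le,
      Real.rpow_neg hv.le]; field_simp
  have h2 : (Real.pi / (t * v + t)) ^ ((N:ℝ) / 2) =
      Real.pi ^ ((N:ℝ) / 2) * t ^ (-((N:ℝ) / 2)) * (1 + v) ^ (-((N:ℝ) / 2)) := by
    rw [show t * v + t = t * (1 + v) by ring, Real.div_rpow hpi.le (by positivity),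
      Real.mul_rpow ht.le (by positivity), Real.rpow_neg ht.le,
      Real.rpow_neg (by positivity)]; field_simp
  have h3 : t * v * t / (t * v + t) * ‖x‖ ^ 2 = ‖x‖ ^ 2 * (v / (1 + v)) * t := by
    field_simp; ring
  have h4 : t ^ (s - σ - 1) = t ^ (-σ - 1) * t ^ ((N:ℝ) / 2 + s) * t ^ (-((N:ℝ) / 2)) := by
    rw [← Real.rpow_add ht, ← Real.rpow_add ht]; congr 1; ring
  rw [h1, h2, h3, h4, mul_comm t (‖x‖ ^ 2)]
  ring

lemma inner_t {N : ℕ} {s σ : ℝ} (hσs : σ < s) {x : EN N} (hx : x ≠ 0) {v : ℝ} (hv : 0 < v) :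
    ∫ t in Ioi (0:ℝ), 2 * Real.pi ^ ((N:ℝ) / 2) * v ^ ((N:ℝ) / 2 + s - 1) *
      (v ^ (-((N:ℝ) / 2)) * (t ^ (s - σ - 1) * Real.exp (-(‖x‖ ^ 2 * t))) -
       (1 + v) ^ (-((N:ℝ) / 2)) * (t ^ (s - σ - 1) * Real.exp (-(‖x‖ ^ 2 * (v / (1 + v)) * t))))
    = 2 * Real.pi ^ ((N:ℝ) / 2) * Real.Gamma (s - σ) * ‖x‖ ^ (2 * σ - 2 * s) *
      (v ^ (s - 1) * (1 - (v / (1 + v)) ^ ((N:ℝ) / 2 + σ - s))) := by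
  have hρ : 0 < ‖x‖ := norm_pos_iff.2 hx
  have h1 : 0 < ‖x‖ ^ 2 := by positivity
  have h2 : 0 < ‖x‖ ^ 2 * (v / (1 + v)) := by positivity
  have h0 : 0 < s - σ := by linarith
  rw [integral_const_mul, integral_sub ((gam_int h0 h1).const_mul _) ((gam_int h0 h2).const_mul _),
    integral_const_mul, integral_const_mul, Real.integral_rpow_mul_exp_neg_mul_Ioi h0 h1,
    Real.integral_rpow_mul_exp_neg_mul_Ioi h0 h2, one_div, one_div, mul_inv,
    Real.mul_rpow (by positivity) (by positivity)]
  have e1 : ((‖x‖ ^ 2)⁻¹) ^ (s - σ) = ‖x‖ ^ (2 * σ - 2 * s) := by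
    rw [Real.inv_rpow h1.le, ← Real.rpow_neg h1.le, ← Real.rpow_natCast,
      ← Real.rpow_mul hρ.le]
    congr 1; push_cast; ring
  have e2 : v ^ (s - 1) = v ^ ((N:ℝ) / 2 + s - 1) * v ^ (-((N:ℝ) / 2)) := by
    rw [← Real.rpow_add hv]; congr 1; ring
  have e3 : v ^ (s - 1) * (v / (1 + v)) ^ ((N:ℝ) / 2 + σ - s) = 
      v ^ ((N:ℝ) / 2 + s - 1) * (1 + v) ^ (-((N:ℝ) / 2)) * ((v / (1 + v))⁻¹) ^ (s - σ) := by
    have hv1 : 0 < 1 + v := by linarith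
    have hq : 0 < v / (1 + v) := by positivity
    rw [Real.inv_rpow hq.le, ← Real.rpow_neg hq.le, Real.div_rpow hv.le hv1.le,
      Real.div_rpow hv.le hv1.le, div_eq_mul_inv (v ^ ((N:ℝ) / 2 + σ - s)), div_eq_mul_inv (v ^ (-(s - σ))),
      ← Real.rpow_neg hv1.le, ← Real.rpow_neg hv1.le]
    have a1 : v ^ ((N:ℝ) / 2 + s - 1) * v ^ (-(s - σ)) = v ^ (s - 1) * v ^ ((N:ℝ) / 2 + σ - s) := by
      rw [← Real.rpow_add hv, ← Real.rpow_add hv]; congr 1; ring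
    have a2 : (1 + v) ^ (-((N:ℝ) / 2 + σ - s)) = 
       (1 + v) ^ (-((N:ℝ) / 2)) * (1 + v) ^ (-(-(s - σ))) := by
      rw [← Real.rpow_add hv1]; congr 1; ring
    rw [a2]
    linear_combination (-((1 + v) ^ (-((N:ℝ) / 2)) * (1 + v) ^ (-(-(s - σ))))) * a1
  rw [mul_sub (v ^ (s - 1)), mul_one, e3, e1, e2]
  ring

lemma total_int {N : ℕ} (hN : 2 ≤ N) {s σ : ℝ} (hs : 0 < s) (hs1 : s < 1) (hσ0 : σ ≠ 0)
    (hσN : -(N:ℝ) < 2 * σ) (hσs : σ < s) {x : EN N} (hx : x ≠ 0) :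
    Integrable (fun y : EN N => (2 * ‖x‖ ^ (2 * σ) - ‖x + y‖ ^ (2 * σ) - ‖x - y‖ ^ (2 * σ)) *
        ‖y‖ ^ (-((N:ℝ) + 2 * s))) ∧
    Real.Gamma ((N:ℝ) / 2 + s) * (Real.Gamma (-σ) *
      ∫ y : EN N, (2 * ‖x‖ ^ (2 * σ) - ‖x + y‖ ^ (2 * σ) - ‖x - y‖ ^ (2 * σ)) *
        ‖y‖ ^ (-((N:ℝ) + 2 * s))) =
    2 * Real.pi ^ ((N:ℝ) / 2) * Real.Gamma (s - σ) * ‖x‖ ^ (2 * σ - 2 * s) *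
      (Real.Gamma (1 - s) * Real.Gamma ((N:ℝ) / 2 + σ) / (s * Real.Gamma ((N:ℝ) / 2 + σ - s))) := by
  have := nontriv_EN hN
  obtain ⟨hF, hFv⟩ := F_integrable hN hs hs1 hσ0 hσN hσs hx
  have hG : Real.Gamma (-σ) ≠ 0 := by
    apply Real.Gamma_ne_zero
    intro m hm
    have hm' : σ = m := by linarith
    rcases Nat.eq_zero_or_pos m with h | h
    · subst h; simp at hm'; exact hσ0 hm'
    · have : (1:ℝ) ≤ m := by exact_mod_cast h
      linarith
  have hα : 0 < (N:ℝ) / 2 + s := by positivity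
  have hGα := Real.Gamma_pos_of_pos hα
  set F : EN N × ℝ → ℝ := fun p : EN N × ℝ => p.2 ^ (-σ - 1) * (2 * Real.exp (-(p.2 * ‖x‖ ^ 2))
      - Real.exp (-(p.2 * ‖x + p.1‖ ^ 2)) - Real.exp (-(p.2 * ‖x - p.1‖ ^ 2)))
        * ‖p.1‖ ^ (-((N:ℝ) + 2 * s)) with hFdef
  set T : (EN N × ℝ) × ℝ → ℝ := fun q => q.1.2 ^ (-σ - 1) * (2 * Real.exp (-(q.1.2 * ‖x‖ ^ 2))
      - Real.exp (-(q.1.2 * ‖x + q.1.1‖ ^ 2)) - Real.exp (-(q.1.2 * ‖x - q.1.1‖ ^ 2)))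
        * (q.1.2 ^ ((N:ℝ) / 2 + s) * (q.2 ^ ((N:ℝ) / 2 + s - 1) *
          Real.exp (-((q.1.2 * ‖q.1.1‖ ^ 2) * q.2)))) with hTdef
  have hpos : ∀ᵐ p ∂((volume : Measure (EN N)).prod (volume.restrict (Ioi (0:ℝ)))),
      p.1 ≠ 0 ∧ 0 < p.2 := by
    have h1 : ∀ᵐ y : EN N, y ≠ 0 := by simp [ae_iff, measure_singleton]
    have h2 : ∀ᵐ t ∂(volume.restrict (Ioi (0:ℝ))), 0 < t := ae_restrict_mem measurableSet_Ioi
    exact (Measure.quasiMeasurePreserving_fst.ae h1).and (Measure.quasiMeasurePreserving_snd.ae h2)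
  have hker : ∀ p : EN N × ℝ, p.1 ≠ 0 → 0 < p.2 →
      ∫ v in Ioi (0:ℝ), p.2 ^ ((N:ℝ) / 2 + s) * (v ^ ((N:ℝ) / 2 + s - 1) *
          Real.exp (-((p.2 * ‖p.1‖ ^ 2) * v))) 
        = ‖p.1‖ ^ (-((N:ℝ) + 2 * s)) * Real.Gamma ((N:ℝ) / 2 + s) := by
    intro p hp1 hp2
    have hy := norm_pos_iff.2 hp1
    rw [integral_const_mul, Real.integral_rpow_mul_exp_neg_mul_Ioi hα (by positivity), one_div,
      Real.inv_rpow (by positivity), Real.mul_rpow hp2.le (by positivity), ← mul_assoc]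
    congr 1
    rw [mul_inv, ← Real.rpow_neg (by positivity : 0 ≤ ‖p.1‖ ^ 2), ← Real.rpow_natCast ‖p.1‖ 2,
      ← Real.rpow_mul hy.le, ← mul_assoc, mul_inv_cancel₀ (by positivity), one_mul]
    congr 1; push_cast; ring
  have hTi : Integrable T (((volume : Measure (EN N)).prod (volume.restrict (Ioi (0:ℝ)))).prod
      (volume.restrict (Ioi (0:ℝ)))) := by
    rw [integrable_prod_iff]
    · constructor
      · filter_upwards [hpos] with p hp
        have hy := norm_pos_iff.2 hp.1
        have ht := hp.2
        simp only [hTdef]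
        exact ((gam_int hα (r := p.2 * ‖p.1‖ ^ 2) (by positivity)).const_mul _).const_mul _
      · refine (hF.norm.mul_const (Real.Gamma ((N:ℝ) / 2 + s))).congr ?_
        filter_upwards [hpos] with p hp
        have ht := hp.2
        have hK : 0 ≤ ‖p.1‖ ^ (-((N:ℝ) + 2 * s)) := by positivity
        have e : ∀ v ∈ Ioi (0:ℝ), ‖T (p, v)‖ = |p.2 ^ (-σ - 1) * (2 * Real.exp (-(p.2 * ‖x‖ ^ 2))
            - Real.exp (-(p.2 * ‖x + p.1‖ ^ 2)) - Real.exp (-(p.2 * ‖x - p.1‖ ^ 2)))| *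
            (p.2 ^ ((N:ℝ) / 2 + s) * (v ^ ((N:ℝ) / 2 + s - 1) *
              Real.exp (-((p.2 * ‖p.1‖ ^ 2) * v)))) := by
          intro v hv
          have hv' : (0:ℝ) < v := hv
          simp only [hTdef]
          rw [norm_mul, Real.norm_eq_abs, Real.norm_eq_abs, abs_of_nonneg (a := p.2 ^ ((N:ℝ) / 2 + s) * _) 
            (by positivity)]
        rw [setIntegral_congr_fun measurableSet_Ioi e, integral_const_mul, hker p hp.1 hp.2]
        simp only [hFdef, norm_mul, Real.norm_eq_abs, abs_mul, abs_of_nonneg hK]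
        ring
    · apply Measurable.aestronglyMeasurable
      simp only [hTdef]
      fun_prop
  have hU : Integrable (fun y : EN N => (2 * ‖x‖ ^ (2 * σ) - ‖x + y‖ ^ (2 * σ) - ‖x - y‖ ^ (2 * σ)) *
        ‖y‖ ^ (-((N:ℝ) + 2 * s))) := by
    refine (hF.integral_prod_left.const_mul (Real.Gamma (-σ))⁻¹).congr ?_
    filter_upwards [hFv] with y hy
    rw [hFdef]
    simp only
    rw [hy]
    field_simp
  refine ⟨hU, ?_⟩
  have s1 : Real.Gamma (-σ) * ∫ y : EN N, (2 * ‖x‖ ^ (2 * σ) - ‖x + y‖ ^ (2 * σ) - ‖x - y‖ ^ (2 * σ)) *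
        ‖y‖ ^ (-((N:ℝ) + 2 * s)) = ∫ p, F p ∂(volume.prod (volume.restrict (Ioi (0:ℝ)))) := by
    rw [integral_prod _ hF, ← integral_const_mul]
    apply integral_congr_ae
    filter_upwards [hFv] with y hy
    rw [hFdef]
    simp only
    rw [hy]
  have s2 : Real.Gamma ((N:ℝ) / 2 + s) * ∫ p, F p ∂((volume : Measure (EN N)).prod (volume.restrict (Ioi (0:ℝ))))
      = ∫ v in Ioi (0:ℝ), ∫ p, T (p, v) ∂((volume : Measure (EN N)).prod (volume.restrict (Ioi (0:ℝ)))) := by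
    rw [← integral_prod_symm _ hTi, integral_prod _ hTi, ← integral_const_mul]
    apply integral_congr_ae
    filter_upwards [hpos] with p hp
    simp only [hTdef]
    rw [integral_const_mul, hker p hp.1 hp.2]
    simp only [hFdef]
    ring
  have s3 : ∀ᵐ v ∂(volume.restrict (Ioi (0:ℝ))),
      ∫ p, T (p, v) ∂((volume : Measure (EN N)).prod (volume.restrict (Ioi (0:ℝ)))) =
      2 * Real.pi ^ ((N:ℝ) / 2) * Real.Gamma (s - σ) * ‖x‖ ^ (2 * σ - 2 * s) *
      (v ^ (s - 1) * (1 - (v / (1 + v)) ^ ((N:ℝ) / 2 + σ - s))) := by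
    filter_upwards [hTi.prod_left_ae, ae_restrict_mem measurableSet_Ioi] with v hv hv0
    have hv0' : (0:ℝ) < v := hv0
    rw [integral_prod_symm _ hv, ← inner_t hσs hx hv0']
    apply setIntegral_congr_fun measurableSet_Ioi
    intro t ht
    exact inner_y x ht hv0'
  have hc : 2 * Real.pi ^ ((N:ℝ) / 2) * Real.Gamma (s - σ) * ‖x‖ ^ (2 * σ - 2 * s) ≠ 0 := by
    have h1 := Real.Gamma_pos_of_pos (show 0 < s - σ by linarith)
    have h2 : 0 < ‖x‖ := norm_pos_iff.2 hx
    have h3 := Real.pi_pos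
    positivity
  have hvi : IntegrableOn (fun v : ℝ => v ^ (s - 1) * (1 - (v / (1 + v)) ^ ((N:ℝ) / 2 + σ - s)))
      (Ioi 0) := by
    have h := (hTi.integral_prod_right).congr s3
    exact (integrable_const_mul_iff (isUnit_iff_ne_zero.2 hc) _).1 h
  rw [s1, s2, integral_congr_ae s3, integral_const_mul, vInt hs hs1 (by linarith) hvi]
  congr 4
  ring

lemma main_aux (N : ℕ) (hN : 2 ≤ N) (s : ℝ) (hs : s ∈ Ioo (0:ℝ) 1) (τ : ℝ)
    (hτ : τ ∈ Ioo (-(N:ℝ)) (2*s)) (hτ0 : τ ≠ 0) (x : EN N) (hx : x ≠ 0) :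
    HasFracLap N s (fun z : EN N => ‖z‖ ^ τ) x (csFun N s τ * ‖x‖ ^ (τ - 2*s)) := by
  have := nontriv_EN hN
  obtain ⟨hs0, hs1⟩ := hs
  obtain ⟨hτN, hτs⟩ := hτ
  obtain ⟨hI, hV⟩ := total_int hN hs0 hs1 (σ := τ / 2) (by simpa using hτ0) (by linarith)
    (by linarith) hx
  have e2 : 2 * (τ / 2) = τ := by ring
  rw [e2] at hI hV
  set U : EN N → ℝ := fun y : EN N => (2 * ‖x‖ ^ τ - ‖x + y‖ ^ τ - ‖x - y‖ ^ τ) *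
        ‖y‖ ^ (-((N:ℝ) + 2 * s)) with hUdef
  have hm : ∀ ε : ℝ, MeasurableSet {y : EN N | ε ≤ ‖y‖} := fun ε =>
    measurableSet_le measurable_const measurable_norm
  have trunc : ∀ ε : ℝ, 0 < ε → ∫ z in {z : EN N | ε ≤ dist x z},
      (‖x‖ ^ τ - ‖z‖ ^ τ) / dist x z ^ ((N:ℝ) + 2*s) = 1 / 2 * ∫ y in {y : EN N | ε ≤ ‖y‖}, U y := by
    intro ε hε
    have hm' : MeasurableSet {z : EN N | ε ≤ dist x z} :=
      measurableSet_le measurable_const (by fun_prop)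
    set g : EN N → ℝ := fun y => (‖x‖ ^ τ - ‖x + y‖ ^ τ) * ‖y‖ ^ (-((N:ℝ) + 2 * s)) with hg
    have a1 : ∫ z in {z : EN N | ε ≤ dist x z},
      (‖x‖ ^ τ - ‖z‖ ^ τ) / dist x z ^ ((N:ℝ) + 2*s) = ∫ y in {y : EN N | ε ≤ ‖y‖}, g y := by
      rw [← integral_indicator hm', ← integral_indicator (hm ε),
        ← integral_add_left_eq_self _ x]
      congr 1; funext y
      simp only [indicator, mem_setOf_eq, dist_self_add_right, hg]
      rw [Real.rpow_neg (norm_nonneg _), div_eq_mul_inv]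
    have a2 : ∫ y in {y : EN N | ε ≤ ‖y‖}, g y = ∫ y in {y : EN N | ε ≤ ‖y‖}, g (-y) := by
      rw [← integral_indicator (hm ε), ← integral_indicator (hm ε), ← integral_neg_eq_self]
      congr 1; funext y
      simp only [indicator, mem_setOf_eq, norm_neg]
    have i1 : IntegrableOn g {y : EN N | ε ≤ ‖y‖} := far_int hN hs0 hτN hτs x hε
    have i2 : IntegrableOn (fun y => g (-y)) {y : EN N | ε ≤ ‖y‖} := by
      refine (far_int hN hs0 hτN hτs (-x) hε).congr_fun ?_ (hm ε)
      intro y _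
      simp only [hg, norm_neg]
      rw [show -x + y = -(x + -y) by abel, norm_neg]
    have a3 : ∫ y in {y : EN N | ε ≤ ‖y‖}, U y = 
        (∫ y in {y : EN N | ε ≤ ‖y‖}, g y) + ∫ y in {y : EN N | ε ≤ ‖y‖}, g (-y) := by
      rw [← integral_add i1 i2]
      congr 1; funext y
      simp only [hg, hUdef, norm_neg, ← sub_eq_add_neg]; ring
    rw [a1, a3, ← a2]; ring
  have hcov : AECover (volume : Measure (EN N)) (𝓝[>] (0:ℝ)) (fun ε => {y : EN N | ε ≤ ‖y‖}) := by
    refine ⟨?_, hm⟩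
    have h1 : ∀ᵐ y : EN N, y ≠ 0 := by simp [ae_iff, measure_singleton]
    filter_upwards [h1] with y hy
    have : Iic ‖y‖ ∈ 𝓝 (0:ℝ) := Iic_mem_nhds (norm_pos_iff.2 hy)
    exact mem_nhdsWithin_of_mem_nhds this
  have hlim := ((hcov.integral_tendsto_of_countably_generated hI).const_mul (1/2)).const_mul (CNs N s)
  have hval : CNs N s * (1 / 2 * ∫ y : EN N, U y) = csFun N s τ * ‖x‖ ^ (τ - 2*s) := by
    have hG : Real.Gamma (-(τ / 2)) ≠ 0 := by
      apply Real.Gamma_ne_zero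
      intro m hm
      rcases Nat.eq_zero_or_pos m with h | h
      · subst h; apply hτ0; simp at hm; linarith
      · have : (1:ℝ) ≤ m := by exact_mod_cast h
        linarith
    have hGα := Real.Gamma_pos_of_pos (show 0 < (N:ℝ) / 2 + s by positivity)
    have hGs := Real.Gamma_pos_of_pos (show 0 < 1 - s by linarith)
    have hpi := Real.rpow_pos_of_pos Real.pi_pos ((N:ℝ) / 2)
    have hIv : ∫ y : EN N, U y = 2 * Real.pi ^ ((N:ℝ) / 2) * Real.Gamma (s - τ / 2) * ‖x‖ ^ (τ - 2 * s) *
      (Real.Gamma (1 - s) * Real.Gamma ((N:ℝ) / 2 + τ / 2) / (s * Real.Gamma ((N:ℝ) / 2 + τ / 2 - s)))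
       / (Real.Gamma ((N:ℝ) / 2 + s) * Real.Gamma (-(τ / 2))) := by
      rw [← hV]; field_simp
    rw [hIv]
    simp only [CNs, csFun]
    rw [show ((N:ℝ) + 2 * s) / 2 = (N:ℝ) / 2 + s by ring,
      show ((N:ℝ) + τ) / 2 = (N:ℝ) / 2 + τ / 2 by ring,
      show (2 * s - τ) / 2 = s - τ / 2 by ring, show -τ / 2 = -(τ / 2) by ring,
      show ((N:ℝ) - 2 * s + τ) / 2 = (N:ℝ) / 2 + τ / 2 - s by ring,
      show -(N:ℝ) / 2 = -((N:ℝ) / 2) by ring, Real.rpow_neg Real.pi_pos.le]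
    rw [div_mul_eq_div_div (Real.Gamma (1 - s) * _) s, div_mul_eq_div_div _ (Real.Gamma (-(τ / 2)))]
    simp only [div_eq_mul_inv _ (Real.Gamma ((N:ℝ) / 2 + τ / 2 - s))]
    field_simp
  rw [hval] at hlim
  refine hlim.congr' ?_
  filter_upwards [self_mem_nhdsWithin] with ε hε
  rw [trunc ε hε]

/-- Lemma 2.1 / Remark 2.2: the fractional Laplacian of `|x|^τ` exists
pointwise on `ℝ^N \ {0}` and equals `c_s(τ)|x|^{τ-2s}`, resp. `0` for `τ ∈ {0, 2s-N}`. -/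
theorem fracLap_of_rpow
    (N : ℕ) (hN : 2 ≤ N) (s : ℝ) (hs : s ∈ Ioo (0:ℝ) 1) :
    (∀ τ ∈ Ioo (-(N:ℝ)) (2*s), τ ≠ 0 → τ ≠ 2*s - N →
      ∀ x : EN N, x ≠ 0 →
        HasFracLap N s (fun z : EN N => ‖z‖ ^ τ) x (csFun N s τ * ‖x‖ ^ (τ - 2*s))) ∧
    (∀ τ : ℝ, (τ = 0 ∨ τ = 2*s - N) →
      ∀ x : EN N, x ≠ 0 →
        HasFracLap N s (fun z : EN N => ‖z‖ ^ τ) x 0) := by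
  have hN' : (2:ℝ) ≤ N := by exact_mod_cast hN
  refine ⟨fun τ hτ h0 _ x hx => main_aux N hN s hs τ hτ h0 x hx, ?_⟩
  intro τ hτ x hx
  by_cases h0 : τ = 0
  · subst h0
    simp [HasFracLap]
  · have hτ' : τ = 2 * s - N := hτ.resolve_left h0
    have h := main_aux N hN s hs τ ⟨by linarith [hs.1], by linarith⟩ h0 x hx
    have hc : csFun N s τ = 0 := by
      simp only [csFun]
      rw [show ((N:ℝ) - 2 * s + τ) / 2 = 0 by rw [hτ']; ring, Real.Gamma_zero]
      simp
    rwa [hc, zero_mul] at h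
end
end
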